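/- arXiv:math/0404524 — 4 statements merged into one kernel-verified Lean document; each statement's English description precedes it below -/
import Mathlib

section
/- Let σ > 1 be fixed. Then for every ε > 0 and all t with |t| ≥ 2, K(σ+it) ≪_{σ,ε} |t|^ε(|t|^{3−2σ} + 1). -/
open MeasureTheory Complex

lemma aux_polylog (P : Polynomial ℝ) (δ : ℝ) (hδ : 0 < δ) :
    ∃ C > 0, ∀ x : ℝ, 1 ≤ x → |P.eval (Real.log x)| ≤ C * x ^ δ := by
  induction P using Polynomial.induction_on' with
  | add p q hp hq =>
    obtain ⟨C1, h1, H1⟩ := hp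
    obtain ⟨C2, h2, H2⟩ := hq
    refine ⟨C1 + C2, by positivity, fun x hx => ?_⟩
    rw [Polynomial.eval_add, add_mul]
    exact (abs_add_le _ _).trans (add_le_add (H1 x hx) (H2 x hx))
  | monomial n a =>
    set η : ℝ := δ / (n + 1) with hη
    have hη0 : 0 < η := by positivity
    refine ⟨(|a| + 1) * (1 / η) ^ n, by positivity, fun x hx => ?_⟩
    have hl : 0 ≤ Real.log x := Real.log_nonneg hx
    have h1 := Real.log_le_rpow_div (by linarith : 0 ≤ x) hη0
    rw [Polynomial.eval_monomial, abs_mul, abs_of_nonneg (pow_nonneg hl n)]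
    have h2 : (Real.log x) ^ n ≤ (1 / η) ^ n * x ^ δ := by
      calc (Real.log x) ^ n ≤ (x ^ η / η) ^ n := by gcongr
        _ = (1 / η) ^ n * x ^ (η * n) := by
          rw [Real.rpow_mul (by linarith), Real.rpow_natCast, ← mul_pow]; congr 1; ring
        _ ≤ _ := by
          gcongr ?_ * ?_
          apply Real.rpow_le_rpow_of_exponent_le hx
          · rw [hη, div_mul_eq_mul_div, div_le_iff₀ (by positivity)]; nlinarith
    calc |a| * Real.log x ^ n ≤ (|a| + 1) * ((1 / η) ^ n * x ^ δ) := by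
          gcongr; linarith
      _ = _ := by ring

lemma aux_mulabs (y : ℝ) : HasDerivAt (fun y : ℝ => y * |y|) (2 * |y|) y := by
  rcases lt_trichotomy y 0 with h | h | h
  · have := (hasDerivAt_id y).mul (hasDerivAt_abs_neg h)
    refine HasDerivAt.congr_deriv this ?_
    rw [abs_of_neg h]; simp only [id]; ring
  · subst h
    rw [hasDerivAt_iff_tendsto_slope]
    simp only [abs_zero, mul_zero]
    have h0 : Filter.Tendsto (fun y : ℝ => |y|) (nhdsWithin 0 {0}ᶜ) (nhds 0) := by
      have := (continuous_abs (G := ℝ)).tendsto 0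
      simp only [abs_zero] at this
      exact this.mono_left nhdsWithin_le_nhds
    refine h0.congr' ?_
    filter_upwards [self_mem_nhdsWithin] with z hz
    have : z ≠ 0 := hz
    simp [slope_def_field]
    field_simp
  · have := (hasDerivAt_id y).mul (hasDerivAt_abs_pos h)
    refine HasDerivAt.congr_deriv this ?_
    rw [abs_of_pos h]; simp only [id]; ring

lemma aux_int (E : ℝ → ℝ) (hc : ContinuousOn E (Set.Ioi 0))
    (hms : ∃ C > 0, ∃ A > 0, ∀ T : ℝ, 2 ≤ T →
      (∫ t in (1:ℝ)..T, (E t) ^ 2) ≤ A * T ^ 2 * Real.log T ^ C) (δ : ℝ) (hδ : 0 < δ) :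
    IntegrableOn (fun x => E x ^ 2 * x ^ (-2 - δ)) (Set.Ioi 1) := by
  obtain ⟨C, hC, A, hA, H⟩ := hms
  have hc2 : ContinuousOn (fun x => E x ^ 2) (Set.Ioi 0) := hc.pow 2
  have hsub : ∀ a b : ℝ, 1 ≤ a → 1 ≤ b → Set.uIcc a b ⊆ Set.Ioi 0 := by
    intro a b ha hb x hx
    have := (le_inf ha hb).trans hx.1
    exact lt_of_lt_of_le one_pos this
  have hii : ∀ a b : ℝ, 1 ≤ a → 1 ≤ b → IntervalIntegrable (fun x => E x ^ 2) volume a b :=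
    fun a b ha hb => (hc2.mono (hsub a b ha hb)).intervalIntegrable
  have hpow : ∀ p : ℝ, ContinuousOn (fun x : ℝ => x ^ p) (Set.Ioi 0) := fun p x hx =>
    (Real.continuousAt_rpow_const x p (Or.inl (ne_of_gt hx))).continuousWithinAt
  set F : ℝ → ℝ := fun T => ∫ t in (1:ℝ)..T, (E t) ^ 2 with hF
  -- bound
  obtain ⟨B, hB, HB⟩ : ∃ B > 0, ∀ x : ℝ, 1 ≤ x → F x ≤ B * x ^ (2 + δ / 2) := by
    set η : ℝ := δ / (2 * C) with hη
    have hη0 : 0 < η := by positivity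
    have hF2 : 0 ≤ F 2 := intervalIntegral.integral_nonneg (by norm_num) (fun x _ => sq_nonneg _)
    refine ⟨A * (1 / η) ^ C + F 2, by positivity, fun x hx => ?_⟩
    have hx0 : 0 < x := by linarith
    rcases le_total 2 x with h | h
    · refine (H x h).trans ?_
      have h1 := Real.log_le_rpow_div hx0.le hη0
      have hl : 0 ≤ Real.log x := Real.log_nonneg hx
      have h2 : Real.log x ^ C ≤ (1 / η) ^ C * x ^ (δ / 2) := by
        calc Real.log x ^ C ≤ (x ^ η / η) ^ C := by gcongr
          _ = ((1 / η) * x ^ η) ^ C := by congr 1; ring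
          _ = (1 / η) ^ C * x ^ (δ / 2) := by
            rw [mul_pow, ← Real.rpow_natCast (x ^ η), ← Real.rpow_mul hx0.le]
            congr 2; rw [hη]; field_simp
      calc A * x ^ 2 * Real.log x ^ C ≤ A * x ^ 2 * ((1 / η) ^ C * x ^ (δ / 2)) := by gcongr
        _ = (A * (1 / η) ^ C) * x ^ (2 + δ / 2) := by
          rw [Real.rpow_add hx0, Real.rpow_two]; ring
        _ ≤ _ := by gcongr; linarith
    · have h1 : F x ≤ F 2 := by
        rw [hF]
        apply intervalIntegral.integral_mono_interval le_rfl hx h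
        · filter_upwards with t using sq_nonneg _
        · exact hii 1 2 le_rfl (by norm_num)
      have h2 : 1 ≤ x ^ (2 + δ / 2) := Real.one_le_rpow hx (by positivity)
      have h3 : 0 < A * (1 / η) ^ C := by positivity
      nlinarith
  refine integrableOn_Ioi_of_intervalIntegral_norm_bounded (l := Filter.atTop) (b := id)
    (B + (2 + δ) * (B * (2 / δ))) 1 ?_ Filter.tendsto_id ?_
  · intro i
    rcases le_total 1 i with h | h
    · have : IntervalIntegrable (fun x => E x ^ 2 * x ^ (-2 - δ)) volume 1 i :=
        ((hc2.mul (hpow _)).mono (hsub 1 i le_rfl h)).intervalIntegrable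
      exact (intervalIntegrable_iff_integrableOn_Ioc_of_le h).1 this
    · simp [Set.Ioc_eq_empty (not_lt.2 h)]
  filter_upwards [Filter.eventually_ge_atTop 1] with T hT
  simp only [id]
  have hT0 : 0 < T := by linarith
  have e1 : (∫ x in (1:ℝ)..T, ‖E x ^ 2 * x ^ (-2 - δ)‖) =
      ∫ x in (1:ℝ)..T, x ^ (-2 - δ) * E x ^ 2 := by
    apply intervalIntegral.integral_congr
    intro x hx
    have hx0 : 0 < x := hsub 1 T le_rfl hT hx
    simp only
    rw [Real.norm_of_nonneg (by positivity), mul_comm]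
  rw [e1]
  have hFd : ∀ x ∈ Set.uIcc 1 T, HasDerivAt F (E x ^ 2) x := by
    intro x hx
    have hx0 : 0 < x := hsub 1 T le_rfl hT hx
    have hx1 : 1 ≤ x := by rw [Set.uIcc_of_le hT] at hx; exact hx.1
    exact intervalIntegral.integral_hasDerivAt_right (hii 1 x le_rfl hx1)
      (hc2.stronglyMeasurableAtFilter isOpen_Ioi x hx0) (hc2.continuousAt (Ioi_mem_nhds hx0))
  have hud : ∀ x ∈ Set.uIcc 1 T, HasDerivAt (fun x : ℝ => x ^ (-2 - δ))
      ((-2 - δ) * x ^ (-2 - δ - 1)) x := by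
    intro x hx
    have hx0 : 0 < x := hsub 1 T le_rfl hT hx
    exact Real.hasDerivAt_rpow_const (Or.inl hx0.ne')
  have hu' : ContinuousOn (fun x : ℝ => (-2 - δ) * x ^ (-2 - δ - 1)) (Set.uIcc 1 T) :=
    (continuousOn_const.mul (hpow _)).mono (hsub 1 T le_rfl hT)
  rw [intervalIntegral.integral_mul_deriv_eq_deriv_mul hud hFd hu'.intervalIntegrable
    (hii 1 T le_rfl hT)]
  have hF1 : F 1 = 0 := by simp [hF]
  rw [hF1, mul_zero, sub_zero, sub_eq_add_neg, ← intervalIntegral.integral_neg]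
  apply add_le_add
  · calc T ^ (-2 - δ) * F T ≤ T ^ (-2 - δ) * (B * T ^ (2 + δ / 2)) := by
          gcongr; exact HB T hT
      _ = B * T ^ (-δ / 2) := by
          rw [mul_left_comm, ← Real.rpow_add hT0]; congr 2; ring
      _ ≤ B * 1 := by
          gcongr; exact Real.rpow_le_one_of_one_le_of_nonpos hT (by linarith)
      _ = B := mul_one _
  · have hFc : ContinuousOn F (Set.uIcc 1 T) := fun x hx =>
      (hFd x hx).continuousAt.continuousWithinAt
    calc (∫ x in (1:ℝ)..T, -((-2 - δ) * x ^ (-2 - δ - 1) * F x))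
        ≤ ∫ x in (1:ℝ)..T, ((2 + δ) * B) * x ^ (-1 - δ / 2) := by
          apply intervalIntegral.integral_mono_on hT
          · exact (hu'.mul hFc).neg.intervalIntegrable
          · exact ((continuousOn_const.mul (hpow _)).mono (hsub 1 T le_rfl hT)).intervalIntegrable
          · intro x hx
            have hx0 : 0 < x := by linarith [hx.1]
            calc -((-2 - δ) * x ^ (-2 - δ - 1) * F x) = (2 + δ) * x ^ (-2 - δ - 1) * F x := by ring
              _ ≤ (2 + δ) * x ^ (-2 - δ - 1) * (B * x ^ (2 + δ / 2)) := by
                gcongr; exact HB x hx.1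
              _ = (2 + δ) * B * (x ^ (-2 - δ - 1) * x ^ (2 + δ / 2)) := by ring
              _ = _ := by rw [← Real.rpow_add hx0]; congr 2; ring
      _ ≤ _ := by
          rw [intervalIntegral.integral_const_mul, integral_rpow]
          · have h1 : 0 < T ^ (-(δ / 2)) := by positivity
            have : (T ^ (-1 - δ / 2 + 1) - 1 ^ (-1 - δ / 2 + 1)) / (-1 - δ / 2 + 1) ≤ 2 / δ := by
              rw [show -1 - δ / 2 + 1 = -(δ / 2) by ring, Real.one_rpow]
              rw [show (T ^ (-(δ / 2)) - 1) / -(δ / 2) = (1 - T ^ (-(δ / 2))) * (2 / δ) by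
                field_simp; ring]
              have : 0 < 2 / δ := by positivity
              nlinarith
            rw [mul_assoc]
            gcongr
          · right
            refine ⟨by linarith, fun h => ?_⟩
            have := hsub 1 T le_rfl hT h
            simp at this

lemma aux_head (E e q : ℝ → ℝ) (hd : ∀ x, 0 < x → HasDerivAt E (e x) x)
    (he : ContinuousOn e (Set.Ioi 0)) (hq : ContinuousOn q (Set.Ioi 0))
    (hq0 : ∀ x, 0 ≤ q x) (heq : ∀ x, 0 < x → - q x ≤ e x)
    (δ D σ m X : ℝ) (hδ : 0 < δ) (hD : 0 < D) (hqD : ∀ x, 1 ≤ x → q x ≤ D * x ^ δ)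
    (hσ : 1 + δ ≤ σ) (hX : 1 ≤ X) (hm0 : 0 ≤ m) (hm : 3 / 2 - σ ≤ m)
    (hI : IntegrableOn (fun x => E x ^ 2 * x ^ (-2 - δ)) (Set.Ioi 1)) :
    2 * (∫ x in (1:ℝ)..X, |E x * e x| * x ^ (-σ)) ≤
      E X ^ 2 * X ^ (-σ) + E 1 ^ 2 + (σ + 2 * D * X ^ (m + 2 * δ)) *
        (∫ x in Set.Ioi (1:ℝ), E x ^ 2 * x ^ (-2 - δ)) + 2 * D * X ^ (m + 2 * δ) * (1 / δ) := by
  have hX0 : 0 < X := by linarith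
  have hsub : Set.uIcc 1 X ⊆ Set.Ioi 0 := by
    rw [Set.uIcc_of_le hX]; intro x hx; exact lt_of_lt_of_le one_pos hx.1
  have hpow : ∀ p : ℝ, ContinuousOn (fun x : ℝ => x ^ p) (Set.Ioi 0) := fun p x hx =>
    (Real.continuousAt_rpow_const x p (Or.inl (ne_of_gt hx))).continuousWithinAt
  have hE : ContinuousOn E (Set.Ioi 0) := fun x hx => (hd x hx).continuousAt.continuousWithinAt
  have ii : ∀ f : ℝ → ℝ, ContinuousOn f (Set.Ioi 0) → IntervalIntegrable f volume 1 X :=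
    fun f hf => (hf.mono hsub).intervalIntegrable
  set I := ∫ x in Set.Ioi (1:ℝ), E x ^ 2 * x ^ (-2 - δ) with hIdef
  have hIX : (∫ x in (1:ℝ)..X, E x ^ 2 * x ^ (-2 - δ)) ≤ I := by
    rw [intervalIntegral.integral_of_le hX]
    apply setIntegral_mono_set hI
    · filter_upwards [ae_restrict_mem measurableSet_Ioi] with x hx
      have : (0:ℝ) < x := lt_trans one_pos hx
      simp only [Pi.zero_apply]; positivity
    · exact (Set.Ioc_subset_Ioi_self).eventuallyLE
  -- integration by parts
  have hparts := intervalIntegral.integral_mul_deriv_eq_deriv_mul (a := 1) (b := X)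
    (u := fun x : ℝ => x ^ (-σ)) (u' := fun x => (-σ) * x ^ (-σ - 1))
    (v := fun x => E x * |E x|) (v' := fun x => 2 * |E x| * e x)
    (fun x hx => Real.hasDerivAt_rpow_const (Or.inl (ne_of_gt (hsub hx))))
    (fun x hx => (aux_mulabs (E x)).comp x (hd x (hsub hx)))
    (ii _ (continuousOn_const.mul (hpow _)))
    (ii _ ((continuousOn_const.mul hE.abs).mul he))
  have h1 : (∫ x in (1:ℝ)..X, x ^ (-σ) * (2 * |E x| * e x)) ≤
      E X ^ 2 * X ^ (-σ) + E 1 ^ 2 + σ * I := by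
    rw [hparts, sub_eq_add_neg _ (∫ x in (1:ℝ)..X, _), ← intervalIntegral.integral_neg]
    apply add_le_add
    · have a1 : E X * |E X| ≤ E X ^ 2 := by
        have := abs_nonneg (E X); have := le_abs_self (E X); rw [← sq_abs]; nlinarith
      have a2 : - (E 1 * |E 1|) ≤ E 1 ^ 2 := by
        have := abs_nonneg (E 1); have := neg_abs_le (E 1); rw [← sq_abs]; nlinarith
      have a3 : 0 < X ^ (-σ) := by positivity
      simp only [Real.one_rpow]
      nlinarith
    · calc _ ≤ ∫ x in (1:ℝ)..X, σ * (E x ^ 2 * x ^ (-2 - δ)) := by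
            apply intervalIntegral.integral_mono_on hX
            · exact ii _ ((continuousOn_const.mul (hpow _)).mul (hE.mul hE.abs)).neg
            · exact ii _ (continuousOn_const.mul ((hE.pow 2).mul (hpow _)))
            · intro x hx
              have hx0 : 0 < x := by linarith [hx.1]
              have a1 : E x * |E x| ≤ E x ^ 2 := by
                have := abs_nonneg (E x); have := le_abs_self (E x); rw [← sq_abs]; nlinarith
              have a2 : x ^ (-σ - 1) ≤ x ^ (-2 - δ) :=
                Real.rpow_le_rpow_of_exponent_le hx.1 (by linarith)
              have hs : 0 < σ := by linarith
              calc -(-σ * x ^ (-σ - 1) * (E x * |E x|)) = σ * (E x * |E x| * x ^ (-σ - 1)) := by ring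
                _ ≤ σ * (E x ^ 2 * x ^ (-2 - δ)) := by gcongr
        _ = σ * ∫ x in (1:ℝ)..X, (E x ^ 2 * x ^ (-2 - δ)) :=
            intervalIntegral.integral_const_mul _ _
        _ ≤ _ := by
            have hs : 0 < σ := by linarith
            gcongr
  have h2 : (∫ x in (1:ℝ)..X, 4 * q x * |E x| * x ^ (-σ)) ≤
      2 * D * X ^ (m + 2 * δ) * I + 2 * D * X ^ (m + 2 * δ) * (1 / δ) := by
    calc _ ≤ ∫ x in (1:ℝ)..X, ((2 * D * X ^ (m + 2 * δ)) * (E x ^ 2 * x ^ (-2 - δ)) +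
              (2 * D * X ^ (m + 2 * δ)) * x ^ (-1 - δ)) := by
          apply intervalIntegral.integral_mono_on hX
          · exact ii _ (((continuousOn_const.mul hq).mul hE.abs).mul (hpow _))
          · exact ii _ ((continuousOn_const.mul ((hE.pow 2).mul (hpow _))).add
              (continuousOn_const.mul (hpow _)))
          · intro x hx
            have hx0 : 0 < x := by linarith [hx.1]
            have b1 : 2 * |E x| ≤ E x ^ 2 * x ^ (-(1/2) : ℝ) + x ^ (1/2 : ℝ) := by
              have c1 : 0 < x ^ (1/2 : ℝ) := by positivity
              rw [Real.rpow_neg hx0.le, ← div_eq_mul_inv, div_add' _ _ _ c1.ne', le_div_iff₀ c1,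
                ← sq_abs (E x)]
              nlinarith [sq_nonneg (|E x| - x ^ (1/2 : ℝ))]
            have b2 : x ^ (3/2 - σ + 2 * δ) ≤ X ^ (m + 2 * δ) :=
              (Real.rpow_le_rpow_of_exponent_le hx.1 (by linarith)).trans
                (Real.rpow_le_rpow hx0.le hx.2 (by linarith))
            calc 4 * q x * |E x| * x ^ (-σ) = 2 * q x * (2 * |E x|) * x ^ (-σ) := by ring
              _ ≤ 2 * (D * x ^ δ) * (E x ^ 2 * x ^ (-(1/2) : ℝ) + x ^ (1/2 : ℝ)) * x ^ (-σ) := by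
                have := hq0 x
                gcongr
                exact hqD x hx.1
              _ = 2 * D * (x ^ δ * x ^ (-(1/2) : ℝ) * x ^ (-σ)) * E x ^ 2 +
                  2 * D * (x ^ δ * x ^ (1/2 : ℝ) * x ^ (-σ)) := by ring
              _ = 2 * D * (x ^ (3/2 - σ + 2 * δ) * x ^ (-2 - δ)) * E x ^ 2 +
                  2 * D * (x ^ (3/2 - σ + 2 * δ) * x ^ (-1 - δ)) := by
                simp only [← Real.rpow_add hx0]
                rw [show δ + -(1/2) + -σ = 3/2 - σ + 2 * δ + (-2 - δ) by ring,
                  show δ + 1/2 + -σ = 3/2 - σ + 2 * δ + (-1 - δ) by ring]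
              _ ≤ 2 * D * (X ^ (m + 2 * δ) * x ^ (-2 - δ)) * E x ^ 2 +
                  2 * D * (X ^ (m + 2 * δ) * x ^ (-1 - δ)) := by gcongr
              _ = _ := by ring
      _ ≤ _ := by
          rw [intervalIntegral.integral_add, intervalIntegral.integral_const_mul,
            intervalIntegral.integral_const_mul, integral_rpow]
          · have : (X ^ (-1 - δ + 1) - 1 ^ (-1 - δ + 1)) / (-1 - δ + 1) ≤ 1 / δ := by
              have h1 : 0 < X ^ (-δ) := by positivity
              rw [show -1 - δ + 1 = -δ by ring, Real.one_rpow]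
              rw [show (X ^ (-δ) - 1) / -δ = (1 - X ^ (-δ)) / δ by field_simp; ring]
              gcongr; linarith
            gcongr
          · right
            refine ⟨by linarith, fun h => ?_⟩
            have := hsub h
            simp at this
          · exact ii _ (continuousOn_const.mul ((hE.pow 2).mul (hpow _)))
          · exact ii _ (continuousOn_const.mul (hpow _))
  have h3 : 2 * (∫ x in (1:ℝ)..X, |E x * e x| * x ^ (-σ)) ≤
      (∫ x in (1:ℝ)..X, x ^ (-σ) * (2 * |E x| * e x)) +
      (∫ x in (1:ℝ)..X, 4 * q x * |E x| * x ^ (-σ)) := by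
    have i1 : IntervalIntegrable (fun x => x ^ (-σ) * (2 * |E x| * e x)) volume 1 X :=
      ii _ ((hpow _).mul ((continuousOn_const.mul hE.abs).mul he))
    have i2 : IntervalIntegrable (fun x => 4 * q x * |E x| * x ^ (-σ)) volume 1 X :=
      ii _ (((continuousOn_const.mul hq).mul hE.abs).mul (hpow _))
    rw [← intervalIntegral.integral_add i1 i2, ← intervalIntegral.integral_const_mul]
    apply intervalIntegral.integral_mono_on hX
    · exact ii _ (continuousOn_const.mul ((hE.mul he).abs.mul (hpow _)))
    · exact i1.add i2
    · intro x hx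
      have hx0 : 0 < x := by linarith [hx.1]
      have k1 : |e x| ≤ e x + 2 * q x := by
        have := heq x hx0; have := hq0 x
        rw [abs_le]; constructor <;> linarith
      rw [abs_mul]
      calc 2 * (|E x| * |e x| * x ^ (-σ)) ≤ 2 * (|E x| * (e x + 2 * q x) * x ^ (-σ)) := by gcongr
        _ = _ := by ring
  nlinarith [h1, h2, h3]

lemma aux_main (E e q : ℝ → ℝ) (hd : ∀ x, 0 < x → HasDerivAt E (e x) x)
    (he : ContinuousOn e (Set.Ioi 0)) (hq : ContinuousOn q (Set.Ioi 0))
    (hq0 : ∀ x, 0 ≤ q x) (heq : ∀ x, 0 < x → - q x ≤ e x)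
    (δ D σ m X t : ℝ) (hδ : 0 < δ) (hD : 0 < D) (hqD : ∀ x, 1 ≤ x → q x ≤ D * x ^ δ)
    (hσ : 1 + δ ≤ σ) (hX : 1 ≤ X) (hm0 : 0 ≤ m) (hm : 3 / 2 - σ ≤ m)
    (hI : IntegrableOn (fun x => E x ^ 2 * x ^ (-2 - δ)) (Set.Ioi 1)) :
    ‖((σ:ℂ) + I * t) * ∫ x in Set.Ioi (1:ℝ), (((E x) ^ 2 : ℝ) : ℂ) * (x : ℂ) ^ (-((σ:ℂ) + I * t) - 1)‖ ≤
      2 * (E X ^ 2 * X ^ (-σ)) + 2 * E 1 ^ 2 + (σ + 2 * D * X ^ (m + 2 * δ)) *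
        (∫ x in Set.Ioi (1:ℝ), E x ^ 2 * x ^ (-2 - δ)) + 2 * D * X ^ (m + 2 * δ) * (1 / δ)
      + (σ + |t|) * X ^ (1 - σ + δ) * (∫ x in Set.Ioi (1:ℝ), E x ^ 2 * x ^ (-2 - δ)) := by
  have hhead := aux_head E e q hd he hq hq0 heq δ D σ m X hδ hD hqD hσ hX hm0 hm hI
  have hX0 : 0 < X := by linarith
  have hs0 : 0 < σ := by linarith
  have hsub : Set.uIcc 1 X ⊆ Set.Ioi 0 := by
    rw [Set.uIcc_of_le hX]; intro x hx; exact lt_of_lt_of_le one_pos hx.1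
  set s : ℂ := (σ:ℂ) + I * t with hs
  have hsre : s.re = σ := by simp [hs]
  have hsn : ‖s‖ ≤ σ + |t| := by
    refine (norm_add_le _ _).trans ?_
    simp [abs_of_pos hs0]
  have hcpow : ∀ p : ℂ, ContinuousOn (fun x : ℝ => (x:ℂ) ^ p) (Set.Ioi 0) := fun p x hx =>
    (Complex.continuousAt_ofReal_cpow_const x p (Or.inr (ne_of_gt hx))).continuousWithinAt
  have hE : ContinuousOn E (Set.Ioi 0) := fun x hx => (hd x hx).continuousAt.continuousWithinAt
  have hEc : ContinuousOn (fun x => ((E x ^ 2 : ℝ) : ℂ)) (Set.Ioi 0) :=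
    Complex.continuous_ofReal.comp_continuousOn (hE.pow 2)
  have hec : ContinuousOn (fun x => ((2 * E x * e x : ℝ) : ℂ)) (Set.Ioi 0) :=
    Complex.continuous_ofReal.comp_continuousOn ((continuousOn_const.mul hE).mul he)
  have hnorm : ∀ x : ℝ, 0 < x → ‖(((E x) ^ 2 : ℝ) : ℂ) * (x : ℂ) ^ (-s - 1)‖ =
      E x ^ 2 * x ^ (-σ - 1) := by
    intro x hx
    rw [norm_mul, Complex.norm_cpow_eq_rpow_re_of_pos hx, Complex.norm_of_nonneg (sq_nonneg _)]
    simp [hsre]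
  have hsubIoi : Set.Ioi (1:ℝ) ⊆ Set.Ioi 0 := Set.Ioi_subset_Ioi zero_le_one
  have hfi : IntegrableOn (fun x : ℝ => (((E x) ^ 2 : ℝ) : ℂ) * (x : ℂ) ^ (-s - 1)) (Set.Ioi 1) := by
    refine Integrable.mono' hI ?_ ?_
    · exact ((hEc.mul (hcpow _)).mono hsubIoi).aestronglyMeasurable measurableSet_Ioi
    · filter_upwards [ae_restrict_mem measurableSet_Ioi] with x hx
      have hx1 : (1:ℝ) < x := hx
      rw [hnorm x (by linarith)]
      gcongr ?_ * ?_
      exact Real.rpow_le_rpow_of_exponent_le hx1.le (by linarith)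
  have hsplit : (∫ x in Set.Ioi (1:ℝ), (((E x) ^ 2 : ℝ) : ℂ) * (x : ℂ) ^ (-s - 1)) =
      (∫ x in (1:ℝ)..X, (((E x) ^ 2 : ℝ) : ℂ) * (x : ℂ) ^ (-s - 1)) +
      ∫ x in Set.Ioi X, (((E x) ^ 2 : ℝ) : ℂ) * (x : ℂ) ^ (-s - 1) := by
    rw [intervalIntegral.integral_of_le hX, ← setIntegral_union _ measurableSet_Ioi
      (hfi.mono_set Set.Ioc_subset_Ioi_self) (hfi.mono_set (Set.Ioi_subset_Ioi hX)),
      Set.Ioc_union_Ioi_eq_Ioi hX]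
    exact Set.Ioc_disjoint_Ioi le_rfl
  have htail : ‖∫ x in Set.Ioi X, (((E x) ^ 2 : ℝ) : ℂ) * (x : ℂ) ^ (-s - 1)‖ ≤
      X ^ (1 - σ + δ) * (∫ x in Set.Ioi (1:ℝ), E x ^ 2 * x ^ (-2 - δ)) := by
    calc _ ≤ ∫ x in Set.Ioi X, X ^ (1 - σ + δ) * (E x ^ 2 * x ^ (-2 - δ)) := by
          apply norm_integral_le_of_norm_le ((hI.mono_set (Set.Ioi_subset_Ioi hX)).const_mul _)
          filter_upwards [ae_restrict_mem measurableSet_Ioi] with x hx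
          have hx1 : X < x := hx
          have hx0 : 0 < x := by linarith
          rw [hnorm x hx0, show -σ - 1 = (1 - σ + δ) + (-2 - δ) by ring, Real.rpow_add hx0]
          have : x ^ (1 - σ + δ) ≤ X ^ (1 - σ + δ) :=
            Real.rpow_le_rpow_of_nonpos hX0 hx1.le (by linarith)
          calc E x ^ 2 * (x ^ (1 - σ + δ) * x ^ (-2 - δ))
              ≤ E x ^ 2 * (X ^ (1 - σ + δ) * x ^ (-2 - δ)) := by gcongr
            _ = _ := by ring
      _ = X ^ (1 - σ + δ) * ∫ x in Set.Ioi X, (E x ^ 2 * x ^ (-2 - δ)) := integral_const_mul _ _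
      _ ≤ _ := by
          gcongr ?_ * ?_
          apply setIntegral_mono_set hI
          · filter_upwards [ae_restrict_mem measurableSet_Ioi] with x hx
            have : (0:ℝ) < x := lt_trans one_pos hx
            simp only [Pi.zero_apply]; positivity
          · exact (Set.Ioi_subset_Ioi hX).eventuallyLE
  have hparts := intervalIntegral.integral_mul_deriv_eq_deriv_mul (a := 1) (b := X)
    (u := fun x => ((E x ^ 2 : ℝ) : ℂ)) (u' := fun x => ((2 * E x * e x : ℝ) : ℂ))
    (v := fun x : ℝ => (x:ℂ) ^ (-s)) (v' := fun x : ℝ => (-s) * (x:ℂ) ^ (-s - 1))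
    (fun x hx => by
      have := ((hd x (hsub hx)).pow 2).ofReal_comp
      refine HasDerivAt.congr_deriv this ?_
      congr 1
      norm_num)
    (fun x hx => by
      have hx0 : 0 < x := hsub hx
      have h := hasDerivAt_ofReal_cpow_const' (x := x) (r := -s - 1) hx0.ne'
        (by intro h
            have := congrArg Complex.re h
            simp [hsre] at this
            linarith)
      have hsne : s ≠ 0 := by
        intro h; rw [h] at hsre; simp at hsre; linarith
      have h2 := h.const_mul (-s)
      refine h2.congr_of_eventuallyEq ?_
      filter_upwards with y
      rw [sub_add_cancel]
      field_simp)
    ((hec.mono hsub).intervalIntegrable)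
    (((continuousOn_const.mul (hcpow _)).mono hsub).intervalIntegrable)
  have hsI : s * (∫ x in (1:ℝ)..X, (((E x) ^ 2 : ℝ) : ℂ) * (x : ℂ) ^ (-s - 1)) =
      -(∫ x in (1:ℝ)..X, (((E x) ^ 2 : ℝ) : ℂ) * (-s * (x : ℂ) ^ (-s - 1))) := by
    rw [← intervalIntegral.integral_const_mul, ← intervalIntegral.integral_neg]
    congr 1; ext x; ring
  have hhead2 : ‖s * (∫ x in (1:ℝ)..X, (((E x) ^ 2 : ℝ) : ℂ) * (x : ℂ) ^ (-s - 1))‖ ≤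
      E X ^ 2 * X ^ (-σ) + E 1 ^ 2 + 2 * (∫ x in (1:ℝ)..X, |E x * e x| * x ^ (-σ)) := by
    rw [hsI, norm_neg, hparts]
    refine (norm_sub_le _ _).trans (add_le_add ((norm_sub_le _ _).trans (add_le_add ?_ ?_)) ?_)
    · rw [norm_mul, Complex.norm_cpow_eq_rpow_re_of_pos hX0, Complex.norm_of_nonneg (sq_nonneg _)]
      simp [hsre]
    · rw [norm_mul, Complex.norm_of_nonneg (sq_nonneg _)]
      simp
    · refine (intervalIntegral.norm_integral_le_integral_norm hX).trans ?_
      rw [← intervalIntegral.integral_const_mul]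
      apply le_of_eq
      apply intervalIntegral.integral_congr
      intro x hx
      simp only
      rw [norm_mul, Complex.norm_cpow_eq_rpow_re_of_pos (hsub hx), Complex.norm_real,
        Real.norm_eq_abs, mul_assoc, abs_mul]
      simp [hsre]; ring
  rw [hsplit, mul_add]
  refine (norm_add_le _ _).trans (add_le_add ?_ ?_)
  · linarith
  · rw [norm_mul, mul_assoc]
    gcongr

theorem stmt_3
    (P4 : Polynomial ℝ) (hdeg : P4.degree = 4)
    (hlead : P4.leadingCoeff = 1 / (2 * Real.pi ^ 2))
    (E2 : ℝ → ℝ)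
    (hE2 : ∀ T : ℝ, E2 T =
      (∫ t in (0:ℝ)..T, ‖riemannZeta (1/2 + Complex.I * t)‖ ^ 4)
        - T * P4.eval (Real.log T))
    (hpt : ∀ ε > 0, ∃ C > 0, ∀ T : ℝ, 2 ≤ T → |E2 T| ≤ C * T ^ ((2:ℝ)/3 + ε))
    (hms : ∃ C > 0, ∃ A > 0, ∀ T : ℝ, 2 ≤ T →
      (∫ t in (1:ℝ)..T, (E2 t) ^ 2) ≤ A * T ^ 2 * Real.log T ^ C)
    (K : ℂ → ℂ)
    (hK : ∀ s : ℂ, 1 < s.re → K s =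
      -(1/2 : ℂ) * ((E2 1 : ℝ) : ℂ) ^ 2 -
        (1/2 : ℂ) * s * ∫ x in Set.Ioi (1:ℝ), (((E2 x) ^ 2 : ℝ) : ℂ) * (x : ℂ) ^ (-s - 1))
    (σ : ℝ) (hσ : 1 < σ) (ε : ℝ) (hε : 0 < ε) :
    ∃ C > 0, ∀ t : ℝ, 2 ≤ |t| →
      ‖K (σ + Complex.I * t)‖ ≤ C * |t| ^ ε * (|t| ^ (3 - 2 * σ) + 1) := by
  set δ : ℝ := min (ε / 4) (σ - 1) with hδdef
  have hδ : 0 < δ := lt_min (by positivity) (by linarith)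
  have hδ1 : δ ≤ ε / 4 := min_le_left _ _
  have hδ2 : δ ≤ σ - 1 := min_le_right _ _
  have hz : Continuous (fun t : ℝ => ‖riemannZeta (1/2 + Complex.I * t)‖ ^ 4) := by
    rw [continuous_iff_continuousAt]
    intro t
    have h1 : (1/2 + Complex.I * t : ℂ) ≠ 1 := by
      intro h
      have := congrArg Complex.re h
      norm_num at this
    have h2 : ContinuousAt (fun t : ℝ => (1/2 + Complex.I * t : ℂ)) t := by fun_prop
    have h3 : ContinuousAt (fun t : ℝ => riemannZeta (1/2 + Complex.I * t)) t :=
      ContinuousAt.comp (f := fun t : ℝ => (1/2 + Complex.I * t : ℂ)) (g := riemannZeta)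
        (differentiableAt_riemannZeta h1).continuousAt h2
    exact h3.norm.pow 4
  set Q : Polynomial ℝ := P4 + Polynomial.derivative P4 with hQ
  set e : ℝ → ℝ := fun x => ‖riemannZeta (1/2 + Complex.I * x)‖ ^ 4 - Q.eval (Real.log x) with he_def
  set q : ℝ → ℝ := fun x => |Q.eval (Real.log x)| with hq_def
  have hlog : ContinuousOn Real.log (Set.Ioi 0) := fun x hx =>
    (Real.continuousAt_log (ne_of_gt hx)).continuousWithinAt
  have hQc : ContinuousOn (fun x => Q.eval (Real.log x)) (Set.Ioi 0) :=
    Q.continuous.comp_continuousOn hlog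
  have hd : ∀ x, 0 < x → HasDerivAt E2 (e x) x := by
    intro x hx
    have h1 : HasDerivAt (fun T => ∫ t in (0:ℝ)..T, ‖riemannZeta (1/2 + Complex.I * t)‖ ^ 4)
        (‖riemannZeta (1/2 + Complex.I * x)‖ ^ 4) x := hz.integral_hasStrictDerivAt 0 x |>.hasDerivAt
    have h2 : HasDerivAt (fun T => T * P4.eval (Real.log T)) (Q.eval (Real.log x)) x := by
      have := (hasDerivAt_id x).mul ((P4.hasDerivAt (Real.log x)).comp x (Real.hasDerivAt_log hx.ne'))
      refine HasDerivAt.congr_deriv this ?_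
      simp only [hQ, Polynomial.eval_add, id, Function.comp]
      field_simp
    have h3 : E2 = fun T => (∫ t in (0:ℝ)..T, ‖riemannZeta (1/2 + Complex.I * t)‖ ^ 4)
        - T * P4.eval (Real.log T) := funext hE2
    rw [h3]
    exact h1.sub h2
  have hE : ContinuousOn E2 (Set.Ioi 0) := fun x hx => (hd x hx).continuousAt.continuousWithinAt
  obtain ⟨D, hD, hqD⟩ := aux_polylog Q δ hδ
  have hI := aux_int E2 hE hms δ hδ
  obtain ⟨C0, hC0, hE0⟩ := hpt (1/12) (by norm_num)
  set J := ∫ x in Set.Ioi (1:ℝ), E2 x ^ 2 * x ^ (-2 - δ) with hJ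
  have hJ0 : 0 ≤ J := by
    apply setIntegral_nonneg measurableSet_Ioi
    intro x hx
    have : (0:ℝ) < x := lt_trans one_pos hx
    positivity
  have hs0 : 0 < σ := by linarith
  refine ⟨E2 1 ^ 2 + (2 * C0 ^ 2 + 2 * E2 1 ^ 2 + (σ + 2 * D) * J + 2 * D * (1 / δ) + (σ + 1) * J),
    by positivity, fun t ht => ?_⟩
  set m : ℝ := max 0 (3 / 2 - σ) with hm
  set X : ℝ := |t| ^ (2:ℝ) with hX
  have ht0 : 0 < |t| := by linarith
  have ht1 : 1 ≤ |t| := by linarith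
  have hX2 : 2 ≤ X := by rw [hX, Real.rpow_two]; nlinarith
  have hX1 : 1 ≤ X := by linarith
  have hX0 : 0 < X := by linarith
  have hXp : ∀ p : ℝ, X ^ p = |t| ^ (2 * p) := fun p => by rw [hX, ← Real.rpow_mul ht0.le]
  have hmain := aux_main E2 e q hd (hz.continuousOn.sub hQc) hQc.abs (fun x => abs_nonneg _)
    (fun x hx => by
      have h1 := le_abs_self (Q.eval (Real.log x))
      have h2 : 0 ≤ ‖riemannZeta (1/2 + Complex.I * x)‖ ^ 4 := by positivity
      simp only [he_def, hq_def]; linarith)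
    δ D σ m X t hδ hD hqD (by linarith) hX1 (le_max_left _ _) (le_max_right _ _) hI
  rw [← hJ] at hmain
  rw [hK _ (by simpa using hσ), mul_assoc]
  set Y := ((σ:ℂ) + I * t) * ∫ x in Set.Ioi (1:ℝ), (((E2 x) ^ 2 : ℝ) : ℂ) * (x : ℂ) ^ (-((σ:ℂ) + I * t) - 1)
  have hn : ‖-(1/2 : ℂ) * ((E2 1 : ℝ) : ℂ) ^ 2 - (1/2 : ℂ) * Y‖ ≤ E2 1 ^ 2 + ‖Y‖ := by
    refine (norm_sub_le _ _).trans (add_le_add ?_ ?_)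
    · rw [norm_mul, norm_pow, Complex.norm_real, Real.norm_eq_abs, sq_abs]
      norm_num
      nlinarith [sq_nonneg (E2 1)]
    · rw [norm_mul]
      norm_num
      nlinarith [norm_nonneg Y]
  set R := |t| ^ ε * (|t| ^ (3 - 2 * σ) + 1) with hR
  have hR1 : R = |t| ^ (3 - 2 * σ + ε) + |t| ^ ε := by
    rw [hR, Real.rpow_add ht0]; ring
  have ha : X ^ (m + 2 * δ) ≤ R := by
    rw [hXp, hR1]
    rcases le_total 0 (3 / 2 - σ) with h | h
    · rw [hm, max_eq_right h]
      have : |t| ^ (2 * (3 / 2 - σ + 2 * δ)) ≤ |t| ^ (3 - 2 * σ + ε) :=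
        Real.rpow_le_rpow_of_exponent_le ht1 (by linarith)
      have : 0 < |t| ^ ε := by positivity
      linarith
    · rw [hm, max_eq_left h]
      have : |t| ^ (2 * (0 + 2 * δ)) ≤ |t| ^ ε :=
        Real.rpow_le_rpow_of_exponent_le ht1 (by linarith)
      have : 0 < |t| ^ (3 - 2 * σ + ε) := by positivity
      linarith
  have hb : E2 X ^ 2 * X ^ (-σ) ≤ C0 ^ 2 * R := by
    have h1 := hE0 X hX2
    calc E2 X ^ 2 * X ^ (-σ) = |E2 X| ^ 2 * X ^ (-σ) := by rw [sq_abs]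
      _ ≤ (C0 * X ^ ((2:ℝ)/3 + 1/12)) ^ 2 * X ^ (-σ) := by gcongr
      _ = C0 ^ 2 * (X ^ ((2:ℝ)/3 + 1/12) * X ^ ((2:ℝ)/3 + 1/12) * X ^ (-σ)) := by ring
      _ = C0 ^ 2 * X ^ (3 / 2 - σ) := by
        rw [← Real.rpow_add hX0, ← Real.rpow_add hX0]; congr 2; ring
      _ ≤ C0 ^ 2 * X ^ (m + 2 * δ) := by
        gcongr ?_ * ?_
        exact Real.rpow_le_rpow_of_exponent_le hX1
          (by linarith [le_max_right 0 (3 / 2 - σ)])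
      _ ≤ _ := by gcongr
  have hc : 1 ≤ R := by
    rw [hR1]
    have h1 : 1 ≤ |t| ^ ε := Real.one_le_rpow ht1 hε.le
    have : 0 < |t| ^ (3 - 2 * σ + ε) := by positivity
    linarith
  have hdd : (σ + |t|) * X ^ (1 - σ + δ) ≤ (σ + 1) * R := by
    calc (σ + |t|) * X ^ (1 - σ + δ) ≤ ((σ + 1) * |t|) * X ^ (1 - σ + δ) := by
          gcongr; nlinarith
      _ = (σ + 1) * |t| ^ (1 + 2 * (1 - σ + δ)) := by
          rw [hXp, Real.rpow_add ht0, Real.rpow_one]; ring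
      _ ≤ (σ + 1) * R := by
          gcongr
          rw [hR1]
          have : |t| ^ (1 + 2 * (1 - σ + δ)) ≤ |t| ^ (3 - 2 * σ + ε) :=
            Real.rpow_le_rpow_of_exponent_le ht1 (by linarith)
          have : 0 < |t| ^ ε := by positivity
          linarith
  refine hn.trans ?_
  rw [mul_assoc, ← hR]
  have t1 : E2 1 ^ 2 ≤ E2 1 ^ 2 * R := le_mul_of_one_le_right (sq_nonneg _) hc
  have t2 : (σ + 2 * D * X ^ (m + 2 * δ)) * J ≤ (σ + 2 * D) * J * R := by
    calc (σ + 2 * D * X ^ (m + 2 * δ)) * J ≤ (σ * R + 2 * D * R) * J := by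
          gcongr; nlinarith
      _ = _ := by ring
  have t3 : 2 * D * X ^ (m + 2 * δ) * (1 / δ) ≤ 2 * D * (1 / δ) * R := by
    calc _ ≤ 2 * D * R * (1 / δ) := by gcongr
      _ = _ := by ring
  have t4 : (σ + |t|) * X ^ (1 - σ + δ) * J ≤ (σ + 1) * J * R := by
    calc _ ≤ (σ + 1) * R * J := by gcongr
      _ = _ := by ring
  linarith
end

section
/- Let σ > 1 be fixed. Then for every ε > 0 and all T ≥ 2, ∫_T^{2T} E₂(t)⁴ dt ≪_{σ,ε} T^{2σ+1}(1 + ∫_0^{T^{1+ε}} |K(σ+it)|²/(1+t²) dt). -/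
open MeasureTheory Complex

lemma ker_lower (T w : ℝ) (hT : 0 < T) (hw : |w| ≤ 1 / T) :
    T / 4 ≤ ∫ t in (0:ℝ)..T, (1 - t / T) * Real.cos (t * w) := by
  have h1 : ∫ t in (0:ℝ)..T, (1 - t / T) * (1/2) = T / 4 := by
    simp [intervalIntegral.integral_sub]
    field_simp
    ring
  rw [← h1]
  apply intervalIntegral.integral_mono_on hT.le
  · apply Continuous.intervalIntegrable; fun_prop
  · apply Continuous.intervalIntegrable; fun_prop
  intro t ht
  have h2 : t / T ≤ 1 := by rw [div_le_one hT]; exact ht.2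
  apply mul_le_mul_of_nonneg_left _ (by linarith)
  have h3 : |t * w| ≤ 1 := by
    rw [abs_mul, abs_of_nonneg ht.1]
    calc t * |w| ≤ T * (1 / T) := by gcongr; exact ht.2
      _ = 1 := by field_simp
  have h4 := Real.one_sub_sq_div_two_le_cos (x := t * w)
  have h5 : (t * w)^2 ≤ 1 := by rwa [sq_le_one_iff_abs_le_one]
  linarith

lemma ker_nonneg (T w : ℝ) (hT : 0 < T) :
    0 ≤ ∫ t in (0:ℝ)..T, (1 - t / T) * Real.cos (t * w) := by
  by_cases hw : w = 0
  · subst hw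
    have := ker_lower T 0 hT (by simp; positivity)
    linarith
  have key : ∫ t in (0:ℝ)..T, (1 - t / T) * Real.cos (t * w) =
      (1 - Real.cos (T * w)) / (T * w ^ 2) := by
    rw [intervalIntegral.integral_eq_sub_of_hasDerivAt
      (f := fun t => (1 - t / T) * (Real.sin (t * w) / w) - Real.cos (t * w) / (T * w ^ 2))]
    · simp; field_simp; ring
    · intro t _
      have ht : HasDerivAt (fun t : ℝ => t * w) w t := by
        simpa using (hasDerivAt_id t).mul_const w
      have h1 : HasDerivAt (fun t : ℝ => 1 - t / T) (-(1 / T)) t := by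
        simpa using ((hasDerivAt_id t).div_const T).const_sub 1
      have h2 := ht.sin.div_const w
      have h3 := ht.cos.div_const (T * w ^ 2)
      refine ((h1.mul h2).sub h3).congr_deriv ?_
      field_simp
      ring
    · apply Continuous.intervalIntegrable; fun_prop
  rw [key]
  have := Real.cos_le_one (T * w)
  apply div_nonneg <;> [linarith; positivity]

lemma normsq_eq {α : Type*} [MeasurableSpace α] (μ : Measure α) [SFinite μ] (g L : α → ℝ)
    (hg : Integrable g μ) (hL : Measurable L) (t : ℝ) :
    ‖∫ x, (g x : ℂ) * cexp (-(t * L x : ℝ) * I) ∂μ‖ ^ 2 =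
      ∫ p, g p.1 * g p.2 * Real.cos (t * (L p.1 - L p.2)) ∂(μ.prod μ) := by
  have hc : Integrable (fun x => g x * Real.cos (t * L x)) μ :=
    hg.mul_bdd (c := 1) (by fun_prop) (by filter_upwards with x; simpa using Real.abs_cos_le_one _)
  have hs : Integrable (fun x => g x * Real.sin (t * L x)) μ :=
    hg.mul_bdd (c := 1) (by fun_prop) (by filter_upwards with x; simpa using Real.abs_sin_le_one _)
  have h1 : ∫ x, (g x : ℂ) * cexp (-(t * L x : ℝ) * I) ∂μ =
      ((∫ x, g x * Real.cos (t * L x) ∂μ : ℝ) : ℂ) - (∫ x, g x * Real.sin (t * L x) ∂μ : ℝ) * I := by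
    rw [← integral_complex_ofReal, ← integral_complex_ofReal, ← integral_mul_const, ← integral_sub]
    · congr 1; ext x
      rw [← ofReal_neg, exp_mul_I, ← ofReal_cos, ← ofReal_sin]
      simp; ring
    · exact hc.ofReal
    · exact hs.ofReal.mul_const _
  rw [h1, ← normSq_eq_norm_sq]
  simp only [normSq_apply, sub_re, sub_im, ofReal_re, ofReal_im, mul_re, mul_im, I_re, I_im]
  have h2 := integral_prod_mul (μ := μ) (ν := μ) (fun x => g x * Real.cos (t * L x)) (fun x => g x * Real.cos (t * L x))
  have h3 := integral_prod_mul (μ := μ) (ν := μ) (fun x => g x * Real.sin (t * L x)) (fun x => g x * Real.sin (t * L x))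
  ring_nf
  rw [sq, sq, ← h2, ← h3, ← integral_add (hc.mul_prod hc) (hs.mul_prod hs)]
  congr 1; ext p
  rw [Real.cos_sub]
  ring

lemma fubini_eq {α : Type*} [MeasurableSpace α] (μ : Measure α) [SFinite μ] (g L : α → ℝ)
    (hg : Integrable g μ) (hL : Measurable L) (T : ℝ) (hT : 0 < T) :
    ∫ t in (0:ℝ)..T, (1 - t / T) * ‖∫ x, (g x : ℂ) * cexp (-(t * L x : ℝ) * I) ∂μ‖ ^ 2 =
      ∫ p, g p.1 * g p.2 * (∫ t in (0:ℝ)..T, (1 - t / T) * Real.cos (t * (L p.1 - L p.2)))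
        ∂(μ.prod μ) := by
  simp_rw [normsq_eq μ g L hg hL, intervalIntegral.integral_of_le hT.le, ← integral_const_mul]
  have hw : Integrable (fun t : ℝ => 1 - t / T) (volume.restrict (Set.Ioc 0 T)) := by
    rw [← IntegrableOn, ← intervalIntegrable_iff_integrableOn_Ioc_of_le hT.le]
    apply Continuous.intervalIntegrable; fun_prop
  rw [integral_integral_swap]
  · congr 1; ext p; congr 1; ext t; ring
  · have := (hw.mul_prod (hg.mul_prod hg)).mul_bdd (c := 1) (g := fun z : ℝ × α × α => Real.cos (z.1 * (L z.2.1 - L z.2.2))) (by fun_prop)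
      (by filter_upwards with x; simpa using Real.abs_cos_le_one _)
    refine this.congr ?_
    filter_upwards with z
    simp [Function.uncurry]; ring

lemma fubini_int {α : Type*} [MeasurableSpace α] (μ : Measure α) [SFinite μ] (g L : α → ℝ)
    (hg : Integrable g μ) (hL : Measurable L) (T : ℝ) (hT : 0 < T) :
    Integrable (fun p : α × α => g p.1 * g p.2 * (∫ t in (0:ℝ)..T, (1 - t / T) * Real.cos (t * (L p.1 - L p.2)))) (μ.prod μ) := by
  simp_rw [intervalIntegral.integral_of_le hT.le, ← integral_const_mul]
  have hw : Integrable (fun t : ℝ => 1 - t / T) (volume.restrict (Set.Ioc 0 T)) := by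
    rw [← IntegrableOn, ← intervalIntegrable_iff_integrableOn_Ioc_of_le hT.le]
    apply Continuous.intervalIntegrable; fun_prop
  have := (hw.mul_prod (hg.mul_prod hg)).mul_bdd (c := 1) (g := fun z : ℝ × α × α => Real.cos (z.1 * (L z.2.1 - L z.2.2))) (by fun_prop)
      (by filter_upwards with x; simpa using Real.abs_cos_le_one _)
  refine this.integral_prod_right.congr ?_
  filter_upwards with z
  congr 1; ext t; ring

lemma log_pow_bound (n : ℕ) (δ : ℝ) (hδ : 0 < δ) :
    ∃ C > 0, ∀ y : ℝ, 1 ≤ y → Real.log y ^ n ≤ C * y ^ δ := by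
  have hd : 0 < δ / (n + 1) := by positivity
  refine ⟨(1 / (δ / (n+1))) ^ n, by positivity, fun y hy => ?_⟩
  have h0 : 0 ≤ y := by linarith
  calc Real.log y ^ n ≤ (y ^ (δ / (n+1)) / (δ / (n+1))) ^ n := by
        gcongr
        · exact Real.log_nonneg hy
        · exact Real.log_le_rpow_div h0 hd
    _ = (1 / (δ / (n+1))) ^ n * y ^ (δ / (n+1) * n) := by
        rw [Real.rpow_mul_natCast h0, ← mul_pow]; congr 1; ring
    _ ≤ _ := by
        gcongr
        · rw [div_mul_eq_mul_div, div_le_iff₀ (by positivity)]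
          nlinarith

lemma poly_log_bound (Q : Polynomial ℝ) (δ : ℝ) (hδ : 0 < δ) :
    ∃ C > 0, ∀ y : ℝ, 1 ≤ y → |Q.eval (Real.log y)| ≤ C * y ^ δ := by
  induction Q using Polynomial.induction_on' with
  | add p q hp hq =>
    obtain ⟨C, hC, h⟩ := hp
    obtain ⟨C', hC', h'⟩ := hq
    refine ⟨C + C', by positivity, fun y hy => ?_⟩
    rw [Polynomial.eval_add]
    have := abs_add_le (p.eval (Real.log y)) (q.eval (Real.log y))
    have := h y hy
    have := h' y hy
    linarith
  | monomial n a =>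
    obtain ⟨C, hC, h⟩ := log_pow_bound n δ hδ
    refine ⟨(|a| + 1) * C, by positivity, fun y hy => ?_⟩
    rw [Polynomial.eval_monomial, abs_mul, abs_pow, abs_of_nonneg (Real.log_nonneg hy), mul_assoc]
    have h1 := h y hy
    have h2 : 0 ≤ Real.log y ^ n := pow_nonneg (Real.log_nonneg hy) _
    gcongr
    linarith

/-- integrability from a bound on the summatory integral -/
lemma integ (f : ℝ → ℝ) (hf : ContinuousOn f (Set.Ici 1)) (hf0 : ∀ x, 0 ≤ f x) (a σ B : ℝ)
    (ha : 0 < a) (hB : 0 < B) (hσ : a < σ + 1)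
    (h : ∀ X : ℝ, 1 ≤ X → ∫ t in (1:ℝ)..X, f t ≤ B * X ^ a) :
    IntegrableOn (fun x => f x * x ^ (-σ - 1)) (Set.Ioi 1) := by
  have hco : ContinuousOn (fun x : ℝ => f x * x ^ (-σ - 1)) (Set.Ici 1) := by
    apply hf.mul
    apply ContinuousOn.rpow_const continuousOn_id
    intro x hx; left; have : (1:ℝ) ≤ x := hx; simp; linarith
  have hsub : ∀ X : ℝ, 1 ≤ X → Set.uIcc 1 X ⊆ Set.Ici 1 := by
    intro X hX; rw [Set.uIcc_of_le hX]; exact Set.Icc_subset_Ici_self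
  apply integrableOn_Ioi_of_intervalIntegral_norm_bounded
    (B + (σ + 1) * B * (1 / (σ + 1 - a))) 1 (b := id) (l := Filter.atTop)
  · intro X
    rcases le_total 1 X with hX | hX
    · exact (intervalIntegrable_iff_integrableOn_Ioc_of_le hX).1
        ((hco.mono (hsub X hX)).intervalIntegrable)
    · simp [hX]
  · exact Filter.tendsto_id
  · filter_upwards [Filter.eventually_ge_atTop 1] with X hX
    simp only [id]
    have e1 : ∫ x in (1:ℝ)..X, ‖f x * x ^ (-σ-1)‖ = ∫ x in (1:ℝ)..X, x ^ (-σ-1) * f x := by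
      apply intervalIntegral.integral_congr
      intro x hx
      have hx : (1:ℝ) ≤ x := hsub X hX hx
      simp only
      rw [Real.norm_of_nonneg (mul_nonneg (hf0 x) (by positivity)), mul_comm]
    rw [e1]
    have hfi : ∀ Y, 1 ≤ Y → IntervalIntegrable f volume 1 Y := fun Y hY =>
      (hf.mono (hsub Y hY)).intervalIntegrable
    have ccont : ContinuousOn (fun x => ∫ t in (1:ℝ)..x, f t) (Set.uIcc 1 X) :=
      intervalIntegral.continuousOn_primitive_interval
        (by rw [Set.uIcc_of_le hX]; exact (hf.mono Set.Icc_subset_Ici_self).integrableOn_Icc)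
    have hrp : ∀ r : ℝ, ContinuousOn (fun x : ℝ => x ^ r) (Set.uIcc 1 X) := by
      intro r
      apply ContinuousOn.rpow_const continuousOn_id
      intro x hx; left; have : (1:ℝ) ≤ x := hsub X hX hx; simp; linarith
    have ibp := intervalIntegral.integral_mul_deriv_eq_deriv_mul_of_hasDerivAt (a := 1) (b := X)
      (u := fun x : ℝ => x ^ (-σ-1)) (u' := fun x => (-σ-1) * x ^ (-σ-1-1))
      (v := fun x => ∫ t in (1:ℝ)..x, f t) (v' := f)
      (hrp _) ccont
      (by
        intro x hx
        have hx1 : 1 < x := by simpa [hX] using hx.1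
        exact Real.hasDerivAt_rpow_const (Or.inl (by linarith)))
      (by
        intro x hx
        have hx1 : 1 < x := by simpa [hX] using hx.1
        exact intervalIntegral.integral_hasDerivAt_right (hfi x hx1.le)
          (hf.stronglyMeasurableAtFilter_nhdsWithin measurableSet_Ici x |>.filter_mono
            (by rw [nhdsWithin_eq_nhds.2 (Ici_mem_nhds hx1)]))
          (hf.continuousAt (Ici_mem_nhds hx1)))
      (by apply ContinuousOn.intervalIntegrable; exact continuousOn_const.mul (hrp _))
      (hfi X hX)
    rw [ibp]
    simp only [intervalIntegral.integral_same, mul_zero, sub_zero]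
    have b1 : X ^ (-σ-1) * ∫ t in (1:ℝ)..X, f t ≤ B := by
      calc _ ≤ X ^ (-σ-1) * (B * X ^ a) := by gcongr; exact h X hX
        _ = B * X ^ (-σ-1+a) := by rw [Real.rpow_add (by linarith)]; ring
        _ ≤ B * 1 := by
          gcongr; apply Real.rpow_le_one_of_one_le_of_nonpos hX; linarith
        _ = B := by ring
    have b2 : -∫ x in (1:ℝ)..X, (-σ-1) * x ^ (-σ-1-1) * ∫ t in (1:ℝ)..x, f t ≤ ∫ x in (1:ℝ)..X, (σ+1) * B * x ^ (-σ-2+a) := by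
      rw [← intervalIntegral.integral_neg]
      apply intervalIntegral.integral_mono_on hX
      · apply ContinuousOn.intervalIntegrable
        exact ((continuousOn_const.mul (hrp _)).mul ccont).neg
      · apply ContinuousOn.intervalIntegrable
        exact continuousOn_const.mul (hrp _)
      intro x hx
      have hx0 : 0 < x := by linarith [hx.1]
      have h1 := h x hx.1
      have : x ^ (-σ-2+a) = x ^ (-σ-1-1) * x ^ a := by rw [← Real.rpow_add hx0]; ring_nf
      rw [this]
      have h3 : 0 ≤ (σ + 1) * x ^ (-σ-1-1) := by
        have : 0 < σ + 1 := by linarith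
        positivity
      nlinarith
    have b3 : ∫ x in (1:ℝ)..X, (σ+1) * B * x ^ (-σ-2+a) ≤ (σ + 1) * B * (1 / (σ + 1 - a)) := by
      rw [intervalIntegral.integral_const_mul]
      have : 0 < σ + 1 := by linarith
      gcongr
      rw [integral_rpow (Or.inr ⟨by linarith, by
        rw [Set.uIcc_of_le hX]; intro h; linarith [h.1]⟩)]
      rw [Real.one_rpow, ← neg_div_neg_eq]
      rw [show -(-σ - 2 + a + 1) = σ + 1 - a by ring]
      have := Real.rpow_nonneg (x := X) (by linarith) (-σ - 2 + a + 1)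
      have : 0 < σ + 1 - a := by linarith
      gcongr
      linarith
    linarith

lemma log_close (T x y : ℝ) (hT : 2 ≤ T) (hx : T < x) (hxy : |x - y| ≤ 1 / 2) :
    |Real.log x - Real.log y| ≤ 1 / T := by
  obtain ⟨h1, h2⟩ := abs_le.1 hxy
  have hx0 : 0 < x := by linarith
  have hy0 : 0 < y := by linarith
  have key : ∀ a b : ℝ, 0 < a → T - 1 / 2 ≤ b → a - b ≤ 1 / 2 →
      Real.log a - Real.log b ≤ 1 / T := by
    intro a b ha hb hab
    have hb0 : 0 < b := by linarith
    rw [← Real.log_div ha.ne' hb0.ne']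
    have := Real.log_le_sub_one_of_pos (div_pos ha hb0)
    have h3 : a / b - 1 ≤ 1 / T := by
      rw [div_sub_one hb0.ne', div_le_div_iff₀ hb0 (by linarith)]
      nlinarith
    linarith
  rw [abs_le]
  constructor
  · have := key y x hy0 (by linarith) (by linarith)
    linarith
  · exact key x y hx0 (by linarith) (by linarith)

lemma core (f g : ℝ → ℝ) (hf : ContinuousOn f (Set.Ici 1)) (hf0 : ∀ x, 0 ≤ f x)
    (hg0 : ∀ x, 0 ≤ g x) (hg : IntegrableOn g (Set.Ioi 1)) (T M R : ℝ) (hT : 2 ≤ T)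
    (hM : 0 ≤ M) (hfg : ∀ x, 1 < x → x ≤ 3 * T → f x ≤ M * g x)
    (hloc : ∀ x, T ≤ x → x ≤ 2 * T → f x ≤ 4 * (∫ y in (x - 1/2)..(x + 1/2), f y) + R) :
    ∫ x in T..(2 * T), f x ^ 2 ≤ 16 * M ^ 2 / T *
      (∫ t in (0:ℝ)..T, (1 - t / T) *
        ‖∫ x in Set.Ioi (1:ℝ), (g x : ℂ) * cexp (-(t * Real.log x : ℝ) * I)‖ ^ 2)
      + R * ∫ x in T..(2 * T), f x := by
  have hT0 : 0 < T := by linarith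
  set μ := volume.restrict (Set.Ioi (1:ℝ)) with hμ
  have hg' : Integrable g μ := hg
  rw [fubini_eq μ g Real.log hg' Real.measurable_log T hT0]
  set S : Set (ℝ × ℝ) := {p | T < p.1 ∧ p.1 ≤ 2 * T ∧ |p.1 - p.2| ≤ 1 / 2} with hS
  have hSm : MeasurableSet S := by
    have h1 : MeasurableSet {p : ℝ × ℝ | T < p.1} := measurableSet_lt (by fun_prop) (by fun_prop)
    have h2 : MeasurableSet {p : ℝ × ℝ | p.1 ≤ 2 * T} := measurableSet_le (by fun_prop) (by fun_prop)
    have h3 : MeasurableSet {p : ℝ × ℝ | |p.1 - p.2| ≤ 1 / 2} :=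
      measurableSet_le (by fun_prop) (by fun_prop)
    exact h1.inter (h2.inter h3)
  set H : ℝ × ℝ → ℝ := S.indicator (fun p => g p.1 * g p.2 * (T / 4)) with hH
  have hHi : Integrable H (μ.prod μ) := ((hg'.mul_prod hg').mul_const _).indicator hSm
  have hle : ∫ p, H p ∂(μ.prod μ) ≤ ∫ p, g p.1 * g p.2 * (∫ t in (0:ℝ)..T, (1 - t / T) * Real.cos (t * (Real.log p.1 - Real.log p.2))) ∂(μ.prod μ) := by
    apply integral_mono hHi (fubini_int μ g Real.log hg' Real.measurable_log T hT0)
    intro p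
    have hgg := mul_nonneg (hg0 p.1) (hg0 p.2)
    by_cases hp : p ∈ S
    · simp only [hH, Set.indicator_of_mem hp]
      apply mul_le_mul_of_nonneg_left _ hgg
      exact ker_lower _ _ hT0 (log_close T _ _ hT hp.1 hp.2.2)
    · simp only [hH, Set.indicator_of_notMem hp]
      exact mul_nonneg hgg (ker_nonneg _ _ hT0)
  refine le_trans ?_ (add_le_add_left (mul_le_mul_of_nonneg_left hle (by positivity)) _)
  rw [integral_prod _ hHi]
  have hsub : Set.Ioc T (2 * T) ⊆ Set.Ioi 1 := fun x hx => by
    have := hx.1; simp only [Set.mem_Ioi]; linarith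
  have hconv : ∀ φ : ℝ → ℝ, ∫ x in T..(2*T), φ x = ∫ x, (Set.Ioc T (2*T)).indicator φ x ∂μ := by
    intro φ
    rw [intervalIntegral.integral_of_le (by linarith), integral_indicator measurableSet_Ioc, hμ,
      Measure.restrict_restrict measurableSet_Ioc, Set.inter_eq_left.2 hsub]
  have hconvi : ∀ φ : ℝ → ℝ, ContinuousOn φ (Set.Ici 1) → Integrable ((Set.Ioc T (2*T)).indicator φ) μ := by
    intro φ hφ
    rw [integrable_indicator_iff measurableSet_Ioc, IntegrableOn, hμ,
      Measure.restrict_restrict measurableSet_Ioc, Set.inter_eq_left.2 hsub]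
    apply IntegrableOn.mono_set (t := Set.Icc T (2*T)) _ Set.Ioc_subset_Icc_self
    apply ContinuousOn.integrableOn_Icc
    exact hφ.mono (fun x hx => by have := hx.1; simp only [Set.mem_Ici]; linarith)
  rw [hconv, hconv, ← integral_const_mul, ← integral_const_mul, ← integral_add
    (hHi.integral_prod_left.const_mul _) ((hconvi f hf).const_mul _)]
  apply integral_mono (hconvi _ (hf.pow 2))
    ((hHi.integral_prod_left.const_mul _).add ((hconvi f hf).const_mul _))
  intro x
  by_cases hx : x ∈ Set.Ioc T (2 * T)
  · simp only [Set.indicator_of_mem hx, Pi.add_apply, Pi.pow_apply]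
    have hIcc : Set.Icc (x - 1/2) (x + 1/2) ⊆ Set.Ioi 1 := fun y hy => by
      have := hy.1; have := hx.1; simp only [Set.mem_Ioi]; linarith
    have e1 : ∫ y, H (x, y) ∂μ = g x * (T / 4) * ∫ y in (x - 1/2)..(x + 1/2), g y := by
      have : ∀ y, H (x, y) = (Set.Icc (x - 1/2) (x + 1/2)).indicator (fun y => g x * (T / 4) * g y) y := by
        intro y
        by_cases hy : y ∈ Set.Icc (x - 1/2) (x + 1/2)
        · have : (x, y) ∈ S := ⟨hx.1, hx.2, abs_le.2 ⟨by linarith [hy.2], by linarith [hy.1]⟩⟩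
          simp only [hH, Set.indicator_of_mem this, Set.indicator_of_mem hy]
          ring
        · have : (x, y) ∉ S := fun h => hy ⟨by linarith [(abs_le.1 h.2.2).2], by linarith [(abs_le.1 h.2.2).1]⟩
          simp only [hH, Set.indicator_of_notMem this, Set.indicator_of_notMem hy]
      simp_rw [this]
      rw [integral_indicator measurableSet_Icc, hμ, Measure.restrict_restrict measurableSet_Icc,
        Set.inter_eq_left.2 hIcc, integral_Icc_eq_integral_Ioc,
        ← intervalIntegral.integral_of_le (by linarith), intervalIntegral.integral_const_mul]
    rw [e1]
    have e2 : ∫ y in (x - 1/2)..(x + 1/2), f y ≤ M * ∫ y in (x - 1/2)..(x + 1/2), g y := by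
      rw [← intervalIntegral.integral_const_mul]
      apply intervalIntegral.integral_mono_on (by linarith)
      · apply ContinuousOn.intervalIntegrable
        rw [Set.uIcc_of_le (by linarith)]
        exact hf.mono (hIcc.trans Set.Ioi_subset_Ici_self)
      · rw [intervalIntegrable_iff_integrableOn_Icc_of_le (by linarith)]
        exact (hg.mono_set hIcc).const_mul _
      · intro y hy
        exact hfg y (hIcc hy) (by linarith [hy.2, hx.2])
    have e3 := hloc x hx.1.le hx.2
    have e4 := hfg x (hsub hx) (by linarith [hx.2])
    have e5 : 0 ≤ ∫ y in (x - 1/2)..(x + 1/2), g y :=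
      intervalIntegral.integral_nonneg (by linarith) (fun y _ => hg0 y)
    set G := ∫ y in (x - 1/2)..(x + 1/2), g y
    have e6 : f x ≤ 4 * (M * G) + R := by linarith
    have e7 : f x * f x ≤ f x * (4 * (M * G) + R) := mul_le_mul_of_nonneg_left e6 (hf0 x)
    have e8 : f x * (4 * (M * G)) ≤ M * g x * (4 * (M * G)) :=
      mul_le_mul_of_nonneg_right e4 (by positivity)
    have e9 : 16 * M ^ 2 / T * (g x * (T / 4) * G) = M * g x * (4 * (M * G)) := by
      field_simp; ring
    rw [e9]
    nlinarith
  · simp only [Set.indicator_of_notMem hx, Pi.add_apply]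
    have : ∀ y, H (x, y) = 0 := by
      intro y
      have : (x, y) ∉ S := fun h => hx ⟨h.1, h.2.1⟩
      simp only [hH, Set.indicator_of_notMem this]
    simp [this]

lemma zeta_cont : Continuous (fun t : ℝ => ‖riemannZeta (1/2 + Complex.I * t)‖ ^ 4) := by
  apply Continuous.pow
  apply Continuous.norm
  rw [continuous_iff_continuousAt]
  intro t
  have h : (1/2 + Complex.I * t : ℂ) ≠ 1 := by
    intro h
    have := congrArg Complex.re h
    norm_num at this
  exact ContinuousAt.comp (f := fun t : ℝ => (1/2 + Complex.I * t : ℂ))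
    (differentiableAt_riemannZeta h).continuousAt (by fun_prop)

lemma main_deriv (P : Polynomial ℝ) (y : ℝ) (hy : 0 < y) :
    HasDerivAt (fun T => T * P.eval (Real.log T))
      (P.eval (Real.log y) + P.derivative.eval (Real.log y)) y := by
  have h1 := (P.hasDerivAt (Real.log y)).comp y (Real.hasDerivAt_log hy.ne')
  refine ((hasDerivAt_id y).mul h1).congr_deriv ?_
  simp
  field_simp

lemma E2_cont (P4 : Polynomial ℝ) (E2 : ℝ → ℝ)
    (hE2 : ∀ T : ℝ, E2 T =
      (∫ t in (0:ℝ)..T, ‖riemannZeta (1/2 + Complex.I * t)‖ ^ 4)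
        - T * P4.eval (Real.log T)) : ContinuousOn E2 (Set.Ici 1) := by
  have : E2 = fun T => (∫ t in (0:ℝ)..T, ‖riemannZeta (1/2 + Complex.I * t)‖ ^ 4)
        - T * P4.eval (Real.log T) := funext hE2
  rw [this]
  apply ContinuousOn.sub
  · exact (intervalIntegral.continuous_primitive (fun a b => zeta_cont.intervalIntegrable a b) 0).continuousOn
  · intro x hx
    have hx : (1:ℝ) ≤ x := hx
    exact (main_deriv P4 x (by linarith)).continuousAt.continuousWithinAt

lemma E2_drop (P4 : Polynomial ℝ) (E2 : ℝ → ℝ)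
    (hE2 : ∀ T : ℝ, E2 T =
      (∫ t in (0:ℝ)..T, ‖riemannZeta (1/2 + Complex.I * t)‖ ^ 4)
        - T * P4.eval (Real.log T)) :
    ∃ C > 0, ∀ a b : ℝ, 1 ≤ a → a ≤ b → E2 a - E2 b ≤ C * b ^ (1/4 : ℝ) * (b - a) := by
  obtain ⟨C, hC, h⟩ := poly_log_bound P4 (1/4) (by norm_num)
  obtain ⟨C', hC', h'⟩ := poly_log_bound P4.derivative (1/4) (by norm_num)
  refine ⟨C + C', by positivity, fun a b ha hab => ?_⟩
  have h1 : (∫ t in (0:ℝ)..b, ‖riemannZeta (1/2 + Complex.I * t)‖ ^ 4) -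
      (∫ t in (0:ℝ)..a, ‖riemannZeta (1/2 + Complex.I * t)‖ ^ 4) =
      ∫ t in a..b, ‖riemannZeta (1/2 + Complex.I * t)‖ ^ 4 :=
    intervalIntegral.integral_interval_sub_left (zeta_cont.intervalIntegrable _ _)
      (zeta_cont.intervalIntegrable _ _)
  have h2 : 0 ≤ ∫ t in a..b, ‖riemannZeta (1/2 + Complex.I * t)‖ ^ 4 :=
    intervalIntegral.integral_nonneg hab (fun t _ => by positivity)
  have h3 := Convex.norm_image_sub_le_of_norm_hasDerivWithin_le (s := Set.Icc a b) (x := a) (y := b)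
    (C := (C + C') * b ^ (1/4 : ℝ))
    (fun y hy => (main_deriv P4 y (by linarith [hy.1])).hasDerivWithinAt)
    (fun y hy => by
      have hy1 : 1 ≤ y := by linarith [hy.1]
      have := h y hy1
      have := h' y hy1
      have h5 : y ^ (1/4 : ℝ) ≤ b ^ (1/4 : ℝ) := by gcongr; exact hy.2
      rw [Real.norm_eq_abs]
      refine (abs_add_le _ _).trans ?_
      nlinarith)
    (convex_Icc a b) ⟨le_refl _, hab⟩ ⟨hab, le_refl _⟩
  rw [Real.norm_eq_abs, Real.norm_of_nonneg (by linarith)] at h3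
  have h4 := le_of_abs_le h3
  rw [hE2, hE2]
  linarith

lemma E2_loc (P4 : Polynomial ℝ) (E2 : ℝ → ℝ)
    (hE2 : ∀ T : ℝ, E2 T =
      (∫ t in (0:ℝ)..T, ‖riemannZeta (1/2 + Complex.I * t)‖ ^ 4)
        - T * P4.eval (Real.log T)) :
    ∃ D > 0, ∀ T : ℝ, 2 ≤ T → ∀ x, T ≤ x → x ≤ 2 * T →
      E2 x ^ 2 ≤ 4 * (∫ y in (x - 1/2)..(x + 1/2), E2 y ^ 2) + D * T ^ (1/2 : ℝ) := by
  obtain ⟨C, hC, h⟩ := E2_drop P4 E2 hE2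
  have hcont := (E2_cont P4 E2 hE2).pow 2
  refine ⟨2 * C ^ 2 * 3 ^ (1/2 : ℝ), by positivity, fun T hT x hx1 hx2 => ?_⟩
  have hii : ∀ a b : ℝ, 1 ≤ a → 1 ≤ b → IntervalIntegrable (fun y => E2 y ^ 2) volume a b := by
    intro a b ha hb
    apply ContinuousOn.intervalIntegrable
    apply hcont.mono
    intro y hy
    exact le_trans (le_min ha hb) hy.1
  have hD : 2 * C ^ 2 * 3 ^ (1/2 : ℝ) * T ^ (1/2 : ℝ) = 2 * (C * (3 * T) ^ (1/4 : ℝ)) ^ 2 := by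
    rw [mul_pow, ← Real.rpow_mul_natCast (by linarith), mul_assoc, ← Real.mul_rpow (by norm_num) (by linarith)]
    norm_num
    ring
  rw [hD]
  set D := C * (3 * T) ^ (1/4 : ℝ) with hDd
  have hDn : 0 ≤ D := by positivity
  have hdrop : ∀ a b : ℝ, 1 ≤ a → a ≤ b → b ≤ 3 * T → b - a ≤ 1 / 2 → E2 a - E2 b ≤ D := by
    intro a b ha hab hb hba
    have h1 : C * b ^ (1/4 : ℝ) ≤ D := by
      have hb0 : 0 ≤ b := by linarith
      rw [hDd]; gcongr
    have := h a b ha hab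
    have h3 : C * b ^ (1/4 : ℝ) * (b - a) ≤ D * (1/2) := by
      apply mul_le_mul h1 hba (by linarith) hDn
    linarith
  have hsplit := intervalIntegral.integral_add_adjacent_intervals
    (hii (x - 1/2) x (by linarith) (by linarith)) (hii x (x + 1/2) (by linarith) (by linarith))
  have n1 : 0 ≤ ∫ y in (x - 1/2)..x, E2 y ^ 2 :=
    intervalIntegral.integral_nonneg (by linarith) (fun t _ => by positivity)
  have n2 : 0 ≤ ∫ y in x..(x + 1/2), E2 y ^ 2 :=
    intervalIntegral.integral_nonneg (by linarith) (fun t _ => by positivity)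
  have gen : ∀ a b : ℝ, 1 ≤ a → b - a = 1 / 2 → (∀ y ∈ Set.Icc a b, |E2 x| ≤ |E2 y| + D) →
      E2 x ^ 2 ≤ 4 * (∫ y in a..b, E2 y ^ 2) + 2 * D ^ 2 := by
    intro a b ha hab hy
    have hab' : a ≤ b := by linarith
    have := intervalIntegral.integral_mono_on (f := fun _ => E2 x ^ 2)
      (g := fun y => 2 * E2 y ^ 2 + 2 * D ^ 2) hab' (by simp)
      (((hii a b ha (by linarith)).const_mul 2).add (by simp))
      (fun y hy' => by
        have h1 := hy y hy'
        have h2 : |E2 x| ^ 2 ≤ (|E2 y| + D) ^ 2 := by gcongr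
        have h3 := sq_nonneg (|E2 y| - D)
        have h4 := sq_abs (E2 x)
        have h5 := sq_abs (E2 y)
        nlinarith)
    rw [intervalIntegral.integral_add ((hii a b ha (by linarith)).const_mul 2) (by simp),
      intervalIntegral.integral_const_mul] at this
    simp only [intervalIntegral.integral_const, hab, smul_eq_mul] at this
    linarith
  rcases le_total 0 (E2 x) with hs | hs
  · have := gen x (x + 1/2) (by linarith) (by ring) (fun y hy => by
      have := hdrop x y (by linarith) hy.1 (by linarith [hy.2]) (by linarith [hy.2])
      have := le_abs_self (E2 y)
      rw [abs_of_nonneg hs]; linarith)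
    linarith
  · have := gen (x - 1/2) x (by linarith) (by ring) (fun y hy => by
      have := hdrop y x (by linarith [hy.1]) hy.2 (by linarith [hy.2]) (by linarith [hy.1])
      have := neg_abs_le (E2 y)
      rw [abs_of_nonpos hs]; linarith)
    linarith

theorem stmt_5
    (P4 : Polynomial ℝ) (hdeg : P4.degree = 4)
    (hlead : P4.leadingCoeff = 1 / (2 * Real.pi ^ 2))
    (E2 : ℝ → ℝ)
    (hE2 : ∀ T : ℝ, E2 T =
      (∫ t in (0:ℝ)..T, ‖riemannZeta (1/2 + Complex.I * t)‖ ^ 4)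
        - T * P4.eval (Real.log T))
    (hpt : ∀ ε > 0, ∃ C > 0, ∀ T : ℝ, 2 ≤ T → |E2 T| ≤ C * T ^ ((2:ℝ)/3 + ε))
    (hms : ∃ C > 0, ∃ A > 0, ∀ T : ℝ, 2 ≤ T →
      (∫ t in (1:ℝ)..T, (E2 t) ^ 2) ≤ A * T ^ 2 * Real.log T ^ C)
    (K : ℂ → ℂ)
    (hK : ∀ s : ℂ, 1 < s.re → K s =
      -(1/2 : ℂ) * ((E2 1 : ℝ) : ℂ) ^ 2 -
        (1/2 : ℂ) * s * ∫ x in Set.Ioi (1:ℝ), (((E2 x) ^ 2 : ℝ) : ℂ) * (x : ℂ) ^ (-s - 1))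
    (σ : ℝ) (hσ : 1 < σ) (ε : ℝ) (hε : 0 < ε) :
    ∃ C > 0, ∀ T : ℝ, 2 ≤ T →
      (∫ t in T..(2 * T), (E2 t) ^ 4)
        ≤ C * T ^ (2 * σ + 1) *
          (1 + ∫ t in (0:ℝ)..(T ^ (1 + ε)), ‖K (σ + Complex.I * t)‖ ^ 2 / (1 + t ^ 2)) := by
  have hcont : ContinuousOn (fun x => E2 x ^ 2) (Set.Ici 1) := (E2_cont P4 E2 hE2).pow 2
  have hf0 : ∀ x, 0 ≤ E2 x ^ 2 := fun x => sq_nonneg _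
  obtain ⟨D, hD, hloc⟩ := E2_loc P4 E2 hE2
  obtain ⟨n, -, A, hA, hms⟩ := hms
  set δ := (σ - 1) / 2 with hδ
  have hδ0 : 0 < δ := by rw [hδ]; linarith
  have hii : ∀ a b : ℝ, 1 ≤ a → 1 ≤ b → IntervalIntegrable (fun y => E2 y ^ 2) volume a b := by
    intro a b ha hb
    apply ContinuousOn.intervalIntegrable
    apply hcont.mono
    intro y hy
    exact le_trans (le_min ha hb) hy.1
  obtain ⟨B, hB, hBb⟩ : ∃ B > 0, ∀ X : ℝ, 1 ≤ X → ∫ t in (1:ℝ)..X, E2 t ^ 2 ≤ B * X ^ (2 + δ) := by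
    obtain ⟨C0, hC0, hl⟩ := log_pow_bound n δ hδ0
    have h2 : ∀ X : ℝ, 2 ≤ X → ∫ t in (1:ℝ)..X, E2 t ^ 2 ≤ A * C0 * X ^ (2 + δ) := by
      intro X hX
      refine (hms X hX).trans ?_
      rw [Real.rpow_add (by linarith), Real.rpow_two]
      calc A * X ^ 2 * Real.log X ^ n ≤ A * X ^ 2 * (C0 * X ^ δ) := by
            gcongr; exact hl X (by linarith)
        _ = _ := by ring
    have h22 : (1:ℝ) ≤ 2 ^ (2 + δ) := Real.one_le_rpow (by norm_num) (by linarith)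
    refine ⟨A * C0 * 2 ^ (2 + δ), by positivity, fun X hX => ?_⟩
    rcases le_total 2 X with h | h
    · refine (h2 X h).trans ?_
      have h8 : A * C0 ≤ A * C0 * 2 ^ (2 + δ) := le_mul_of_one_le_right (by positivity) h22
      exact mul_le_mul_of_nonneg_right h8 (by positivity)
    · have h3 := intervalIntegral.integral_add_adjacent_intervals
        (hii 1 X (by linarith) (by linarith)) (hii X 2 (by linarith) (by linarith))
      have h4 : 0 ≤ ∫ y in X..2, E2 y ^ 2 :=
        intervalIntegral.integral_nonneg (by linarith) (fun t _ => by positivity)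
      have h5 := h2 2 le_rfl
      have h6 : (1:ℝ) ≤ X ^ (2 + δ) := Real.one_le_rpow hX (by linarith)
      have h7 : A * C0 * 2 ^ (2 + δ) ≤ A * C0 * 2 ^ (2 + δ) * X ^ (2 + δ) :=
        le_mul_of_one_le_right (by positivity) h6
      linarith
  have hgi0 := integ (fun x => E2 x ^ 2) hcont hf0 (2 + δ) σ B (by linarith) hB (by linarith) hBb
  set g : ℝ → ℝ := fun x => E2 x ^ 2 * |x| ^ (-σ - 1) with hg
  have hgi : IntegrableOn g (Set.Ioi 1) := by
    refine hgi0.congr_fun ?_ measurableSet_Ioi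
    intro x hx
    have hx : (1:ℝ) < x := hx
    simp only [hg]
    rw [abs_of_pos (by linarith)]
  have hg0 : ∀ x, 0 ≤ g x := fun x => by simp only [hg]; positivity
  set F : ℝ → ℂ := fun t => ∫ x in Set.Ioi (1:ℝ), (g x : ℂ) * cexp (-(t * Real.log x : ℝ) * I) with hF
  have hFc : Continuous F := by
    apply continuous_of_dominated (bound := g)
    · intro t
      apply AEStronglyMeasurable.mul
      · exact hgi.ofReal.aestronglyMeasurable
      · apply Measurable.aestronglyMeasurable; fun_prop
    · intro t
      filter_upwards with x
      rw [norm_mul, ← ofReal_neg, norm_exp_ofReal_mul_I, mul_one, norm_real,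
        Real.norm_of_nonneg (hg0 x)]
    · exact hgi
    · filter_upwards with x
      fun_prop
  have hKF : ∀ t : ℝ, K (σ + I * t) = -(1/2 : ℂ) * ((E2 1 : ℝ) : ℂ) ^ 2 -
        (1/2 : ℂ) * (σ + I * t) * F t := by
    intro t
    rw [hK _ (by simpa using hσ)]
    congr 2
    apply setIntegral_congr_fun measurableSet_Ioi
    intro x hx
    have hx : (1:ℝ) < x := hx
    have hx0 : (0:ℝ) < x := by linarith
    simp only [hg]
    rw [abs_of_pos hx0, ofReal_mul, mul_assoc, ofReal_cpow hx0.le]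
    congr 1
    rw [show (-(σ + I * t) - 1 : ℂ) = ((-σ - 1 : ℝ) : ℂ) + (-(t * I)) by push_cast; ring,
      cpow_add _ _ (by exact_mod_cast hx0.ne')]
    congr 1
    rw [cpow_def_of_ne_zero (by exact_mod_cast hx0.ne'), ← ofReal_log hx0.le]
    congr 1
    push_cast; ring
  have hKc : Continuous (fun t : ℝ => ‖K (σ + I * t)‖ ^ 2 / (1 + t ^ 2)) := by
    simp_rw [hKF]
    apply Continuous.div (by fun_prop) (by fun_prop)
    intro t; positivity
  have hFK : ∀ t : ℝ, ‖F t‖ ^ 2 ≤ 8 * (‖K (σ + I * t)‖ ^ 2 / (1 + t ^ 2)) +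
      2 * E2 1 ^ 4 * (1 / (1 + t ^ 2)) := by
    intro t
    have h1 : (σ + I * t : ℂ) * F t = -(2 * K (σ + I * t) + ((E2 1 ^ 2 : ℝ) : ℂ)) := by
      rw [hKF]; push_cast; ring
    have h2 : ‖(σ + I * t : ℂ)‖ ^ 2 * ‖F t‖ ^ 2 ≤ 8 * ‖K (σ + I * t)‖ ^ 2 + 2 * E2 1 ^ 4 := by
      rw [← mul_pow, ← norm_mul, h1, norm_neg]
      have h3 := norm_add_le (2 * K (σ + I * t)) ((E2 1 ^ 2 : ℝ) : ℂ)
      rw [norm_mul, norm_real, Real.norm_of_nonneg (sq_nonneg _)] at h3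
      norm_num at h3
      have h4 : ‖2 * K (σ + I * t) + ((E2 1 ^ 2 : ℝ) : ℂ)‖ ^ 2 ≤ (2 * ‖K (σ + I * t)‖ + E2 1 ^ 2) ^ 2 := by
        gcongr
        simpa using h3
      have h5 := sq_nonneg (2 * ‖K (σ + I * t)‖ - E2 1 ^ 2)
      nlinarith
    have h3 : ‖(σ + I * t : ℂ)‖ ^ 2 = σ ^ 2 + t ^ 2 := by
      rw [← normSq_eq_norm_sq, mul_comm, normSq_add_mul_I]
    rw [h3] at h2
    have h4 : (1 + t ^ 2) * ‖F t‖ ^ 2 ≤ (σ ^ 2 + t ^ 2) * ‖F t‖ ^ 2 := by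
      gcongr; nlinarith
    have h5 : 8 * (‖K (σ + I * t)‖ ^ 2 / (1 + t ^ 2)) + 2 * E2 1 ^ 4 * (1 / (1 + t ^ 2)) =
      (8 * ‖K (σ + I * t)‖ ^ 2 + 2 * E2 1 ^ 4) / (1 + t ^ 2) := by ring
    rw [h5, le_div_iff₀ (by positivity)]
    linarith
  refine ⟨16 * 3 ^ (2 * σ + 2) * (8 + 4 * E2 1 ^ 4) + D * B * 2 ^ (2 + δ), by positivity, fun T hT => ?_⟩
  have hT0 : 0 < T := by linarith
  set J := ∫ t in (0:ℝ)..(T ^ (1 + ε)), ‖K (σ + Complex.I * t)‖ ^ 2 / (1 + t ^ 2) with hJ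
  have hJ0 : 0 ≤ J := intervalIntegral.integral_nonneg (by positivity) (fun t _ => by positivity)
  have hTT : T ≤ T ^ (1 + ε) := Real.self_le_rpow_of_one_le (by linarith) (by linarith)
  have hcore := core (fun x => E2 x ^ 2) g hcont hf0 hg0 hgi T ((3 * T) ^ (σ + 1)) (D * T ^ (1/2 : ℝ)) hT
    (by positivity)
    (by
      intro x hx1 hx2
      have hx0 : 0 < x := by linarith
      simp only [hg]
      rw [abs_of_pos hx0]
      have h1 : 1 ≤ (3 * T) ^ (σ + 1) * x ^ (-σ - 1) := by
        rw [show -σ - 1 = -(σ + 1) by ring, Real.rpow_neg hx0.le, ← div_eq_mul_inv,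
          one_le_div (by positivity)]
        gcongr
      calc E2 x ^ 2 ≤ E2 x ^ 2 * ((3 * T) ^ (σ + 1) * x ^ (-σ - 1)) :=
            le_mul_of_one_le_right (hf0 x) h1
        _ = _ := by ring)
    (hloc T hT)
  have hI : ∫ t in (0:ℝ)..T, (1 - t / T) * ‖F t‖ ^ 2 ≤ 8 * J + 4 * E2 1 ^ 4 := by
    have hci : Continuous (fun t : ℝ => 1 / (1 + t ^ 2)) :=
      Continuous.div (by fun_prop) (by fun_prop) (fun t => by positivity)
    have s1 : ∫ t in (0:ℝ)..T, (1 - t / T) * ‖F t‖ ^ 2 ≤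
        ∫ t in (0:ℝ)..T, (8 * (‖K (σ + I * t)‖ ^ 2 / (1 + t ^ 2)) + 2 * E2 1 ^ 4 * (1 / (1 + t ^ 2))) := by
      apply intervalIntegral.integral_mono_on hT0.le
      · apply Continuous.intervalIntegrable; fun_prop
      · apply Continuous.intervalIntegrable
        exact (hKc.const_mul 8).add (hci.const_mul _)
      · intro t ht
        refine le_trans ?_ (hFK t)
        apply mul_le_of_le_one_left (by positivity)
        have : 0 ≤ t / T := div_nonneg ht.1 hT0.le
        linarith
    rw [intervalIntegral.integral_add (μ := volume) ((hKc.const_mul 8).intervalIntegrable 0 T)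
      ((hci.const_mul (2 * E2 1 ^ 4)).intervalIntegrable 0 T), intervalIntegral.integral_const_mul,
      intervalIntegral.integral_const_mul, integral_one_div_one_add_sq] at s1
    have s2 : ∫ t in (0:ℝ)..T, ‖K (σ + I * t)‖ ^ 2 / (1 + t ^ 2) ≤ J := by
      have h3 := intervalIntegral.integral_add_adjacent_intervals (μ := volume)
        (hKc.intervalIntegrable 0 T) (hKc.intervalIntegrable T (T ^ (1 + ε)))
      have h4 : 0 ≤ ∫ t in T..(T ^ (1 + ε)), ‖K (σ + I * t)‖ ^ 2 / (1 + t ^ 2) :=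
        intervalIntegral.integral_nonneg hTT (fun t _ => by positivity)
      linarith
    have s3 : Real.arctan T - Real.arctan 0 ≤ 2 := by
      rw [Real.arctan_zero]
      have := Real.arctan_lt_pi_div_two T
      have := Real.pi_le_four
      linarith
    have s4 : 2 * E2 1 ^ 4 * (Real.arctan T - Real.arctan 0) ≤ 2 * E2 1 ^ 4 * 2 := by
      gcongr
    linarith
  have hL : ∫ x in T..(2*T), E2 x ^ 2 ≤ B * (2 * T) ^ (2 + δ) := by
    have h3 := intervalIntegral.integral_add_adjacent_intervals
        (hii 1 T (by linarith) (by linarith)) (hii T (2 * T) (by linarith) (by linarith))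
    have h4 : 0 ≤ ∫ y in (1:ℝ)..T, E2 y ^ 2 :=
      intervalIntegral.integral_nonneg (by linarith) (fun t _ => by positivity)
    have := hBb (2 * T) (by linarith)
    linarith
  have hMM : 16 * ((3 * T) ^ (σ + 1)) ^ 2 / T = 16 * 3 ^ (2 * σ + 2) * T ^ (2 * σ + 1) := by
    rw [← Real.rpow_mul_natCast (by positivity), Real.mul_rpow (by norm_num) hT0.le]
    have : T ^ ((σ + 1) * (2:ℕ)) = T ^ (2 * σ + 1) * T := by
      rw [← Real.rpow_add_one hT0.ne']; congr 1; push_cast; ring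
    rw [this, show (σ + 1) * ((2:ℕ):ℝ) = 2 * σ + 2 by push_cast; ring]
    field_simp
  rw [hMM] at hcore
  have hR : D * T ^ (1/2 : ℝ) * (∫ x in T..(2*T), E2 x ^ 2) ≤ D * B * 2 ^ (2 + δ) * T ^ (2 * σ + 1) := by
    calc _ ≤ D * T ^ (1/2 : ℝ) * (B * (2 * T) ^ (2 + δ)) := by gcongr
      _ = D * B * 2 ^ (2 + δ) * T ^ (1/2 + (2 + δ)) := by
        rw [Real.mul_rpow (by norm_num) hT0.le, Real.rpow_add hT0 (1/2) (2 + δ)]; ring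
      _ ≤ _ := by
        apply mul_le_mul_of_nonneg_left _ (by positivity)
        apply Real.rpow_le_rpow_of_exponent_le (by linarith)
        rw [hδ]; linarith
  have e4 : ∀ x, E2 x ^ 4 = (E2 x ^ 2) ^ 2 := fun x => by ring
  rw [show (fun x => E2 x ^ 4) = (fun x => (E2 x ^ 2) ^ 2) from funext e4]
  refine hcore.trans ?_
  have hP : 0 ≤ 16 * (3:ℝ) ^ (2 * σ + 2) * T ^ (2 * σ + 1) := by positivity
  have f1 := mul_le_mul_of_nonneg_left hI hP
  have f2 : 0 ≤ D * B * 2 ^ (2 + δ) * T ^ (2 * σ + 1) * J := by positivity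
  have f3 : 0 ≤ 16 * (3:ℝ) ^ (2 * σ + 2) * T ^ (2 * σ + 1) * (8 + 4 * E2 1 ^ 4 * J) := by positivity
  have f4 : (16 * 3 ^ (2 * σ + 2) * (8 + 4 * E2 1 ^ 4) + D * B * 2 ^ (2 + δ)) * T ^ (2 * σ + 1) * (1 + J)
    = 16 * (3:ℝ) ^ (2 * σ + 2) * T ^ (2 * σ + 1) * (8 * J + 4 * E2 1 ^ 4) + 16 * (3:ℝ) ^ (2 * σ + 2) * T ^ (2 * σ + 1) * (8 + 4 * E2 1 ^ 4 * J) + D * B * 2 ^ (2 + δ) * T ^ (2 * σ + 1) + D * B * 2 ^ (2 + δ) * T ^ (2 * σ + 1) * J := by ring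
  rw [f4]
  exact (add_le_add f1 hR).trans (by linarith)
end

section
/- Let σ ∈ ℝ, let 2 ≤ a < b ≤ ∞, and let g be a real-valued measurable function on (a,b) such that ∫_a^b |g(x)| x^{−σ} dx < ∞ and ∫_a^b g(x)² x^{1−2σ} dx < ∞. Then for every T > 0, ∫_0^T |∫_a^b g(x) x^{−σ−it} dx|² dt ≤ 2π ∫_a^b g(x)² x^{1−2σ} dx. -/
open MeasureTheory Complex
open scoped FourierTransform SchwartzMap ContDiff

theorem fourier_aeEq_aux (f : ℝ → ℂ) (hf1 : Integrable f) (hf2 : MemLp f 2) :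
    (𝓕 f : ℝ → ℂ) =ᵐ[volume] ((𝓕 (hf2.toLp f) : Lp (α := ℝ) ℂ 2 volume) : ℝ → ℂ) := by
  apply ae_eq_of_integral_contDiff_smul_eq
  · exact (VectorFourier.fourierIntegral_continuous Real.continuous_fourierChar
      (L := innerₗ ℝ) (by exact continuous_inner) hf1).locallyIntegrable
  · exact (Lp.memLp _).locallyIntegrable (by norm_num)
  intro g hg1 hg2
  have hg3 : ContDiff ℝ ∞ (Complex.ofRealCLM ∘ g) := by fun_prop
  have hg4 : HasCompactSupport (Complex.ofRealCLM ∘ g) := hg2.comp_left rfl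
  let φ : 𝓢(ℝ, ℂ) := hg4.toSchwartzMap hg3
  have hφ : ∀ x, φ x = (g x : ℂ) := fun x => rfl
  have e1 : ∫ x, g x • ((𝓕 (hf2.toLp f) : Lp (α := ℝ) ℂ 2 volume) : ℝ → ℂ) x
      = ∫ x, (𝓕 φ) x • f x := by
    have := congrArg (fun D => D φ) (Lp.fourier_toTemperedDistribution_eq (hf2.toLp f))
    simp only [TemperedDistribution.fourier_apply, Lp.toTemperedDistribution_apply] at this
    calc _ = ∫ x, φ x • ((𝓕 (hf2.toLp f) : Lp (α := ℝ) ℂ 2 volume) : ℝ → ℂ) x := by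
          simp [hφ]
      _ = _ := this.symm
      _ = _ := by
          apply integral_congr_ae
          filter_upwards [hf2.coeFn_toLp] with x hx
          rw [hx]
  rw [e1]
  have := VectorFourier.integral_fourierIntegral_smul_eq_flip (μ := volume) (ν := volume)
    (L := innerₗ ℝ) (f := φ) (g := f) Real.continuous_fourierChar (by exact continuous_inner)
    φ.integrable hf1
  rw [flip_innerₗ] at this
  calc _ = ∫ x, φ x • 𝓕 f x := by simp [hφ]
    _ = _ := this.symm

theorem plancherel_aux (f : ℝ → ℂ) (hf1 : Integrable f) (hf2 : MemLp f 2) :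
    Integrable (fun t => ‖𝓕 f t‖ ^ 2) ∧ ∫ t, ‖𝓕 f t‖ ^ 2 = ∫ x, ‖f x‖ ^ 2 := by
  have h := fourier_aeEq_aux f hf1 hf2
  have hm : MemLp (𝓕 f : ℝ → ℂ) 2 := (memLp_congr_ae h).2 (Lp.memLp _)
  refine ⟨(memLp_two_iff_integrable_sq_norm hm.1).1 hm, ?_⟩
  have hn := Lp.norm_fourier_eq (hf2.toLp f)
  have key : ∀ F : Lp (α := ℝ) ℂ 2 volume, ‖F‖ ^ 2 = ∫ x, ‖F x‖ ^ 2 := by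
    intro F
    have := @L2.inner_def ℝ ℂ ℂ _ _ volume _ _ F F
    rw [inner_self_eq_norm_sq_to_K] at this
    simp only [inner_self_eq_norm_sq_to_K] at this
    norm_cast at this
  have k1 := key (hf2.toLp f)
  have k2 := key (𝓕 (hf2.toLp f) : Lp (α := ℝ) ℂ 2 volume)
  rw [hn, k1] at k2
  calc _ = ∫ x, ‖((𝓕 (hf2.toLp f) : Lp (α := ℝ) ℂ 2 volume) : ℝ → ℂ) x‖ ^ 2 := by
        apply integral_congr_ae
        filter_upwards [h] with x hx
        rw [hx]
    _ = _ := k2.symm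
    _ = _ := by
        apply integral_congr_ae
        filter_upwards [hf2.coeFn_toLp] with x hx
        rw [hx]

theorem stmt_8
    (σ a : ℝ) (b : EReal) (ha : (2:ℝ) ≤ a) (hab : (a : EReal) < b)
    (g : ℝ → ℝ) (hg : Measurable g)
    (h1 : IntegrableOn (fun x : ℝ => |g x| * x ^ (-σ))
      {x : ℝ | a < x ∧ (x : EReal) < b})
    (h2 : IntegrableOn (fun x : ℝ => (g x) ^ 2 * x ^ (1 - 2 * σ))
      {x : ℝ | a < x ∧ (x : EReal) < b})
    (T : ℝ) (hT : 0 < T) :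
    (∫ t in (0:ℝ)..T,
      ‖∫ x in {x : ℝ | a < x ∧ (x : EReal) < b},
          ((g x : ℝ) : ℂ) * (x : ℂ) ^ (-(σ : ℂ) - Complex.I * t)‖ ^ 2)
      ≤ 2 * Real.pi *
        ∫ x in {x : ℝ | a < x ∧ (x : EReal) < b}, (g x) ^ 2 * x ^ (1 - 2 * σ) := by
  set s : Set ℝ := {u | a < Real.exp u ∧ ((Real.exp u : ℝ) : EReal) < b} with hs
  have hsm : MeasurableSet s := by
    apply MeasurableSet.inter
    · exact measurableSet_lt measurable_const Real.measurable_exp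
    · exact measurableSet_lt (measurable_coe_real_ereal.comp Real.measurable_exp) measurable_const
  have himg : {x : ℝ | a < x ∧ (x : EReal) < b} = Real.exp '' s := by
    ext x
    constructor
    · rintro ⟨hx1, hx2⟩
      have hx : 0 < x := by linarith
      exact ⟨Real.log x, by simpa [hs, Real.exp_log hx] using ⟨hx1, hx2⟩, Real.exp_log hx⟩
    · rintro ⟨u, hu, rfl⟩
      exact hu
  have hd : ∀ x ∈ s, HasDerivWithinAt Real.exp (Real.exp x) s x :=
    fun x _ => (Real.hasDerivAt_exp x).hasDerivWithinAt
  have hinj : Set.InjOn Real.exp s := Real.exp_injective.injOn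
  rw [himg] at h1 h2 ⊢
  rw [integrableOn_image_iff_integrableOn_abs_deriv_smul hsm hd hinj] at h1 h2
  rw [integral_image_eq_integral_abs_deriv_smul hsm hd hinj]
  let h0 : ℝ → ℝ := fun u => g (Real.exp u) * Real.exp ((1 - σ) * u)
  let h : ℝ → ℂ := s.indicator (fun u => (h0 u : ℂ))
  have hm0 : Measurable h0 := by
    apply Measurable.mul (hg.comp Real.measurable_exp); fun_prop
  have hm : Measurable h := (Complex.measurable_ofReal.comp hm0).indicator hsm
  have hnorm : ∀ u, ‖h u‖ ^ 2 = s.indicator (fun u => h0 u ^ 2) u := by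
    intro u
    by_cases hu : u ∈ s <;> simp [h, hu]
  have e1 : ∀ u, |Real.exp u| • (|g (Real.exp u)| * Real.exp u ^ (-σ)) = ‖(h0 u : ℂ)‖ := by
    intro u
    have : Real.exp ((1 - σ) * u) = Real.exp u * Real.exp u ^ (-σ) := by
      rw [← Real.exp_mul, ← Real.exp_add]; ring_nf
    simp only [h0, Complex.norm_real, Real.norm_eq_abs, abs_mul, Real.abs_exp, smul_eq_mul, this,
      abs_of_pos (Real.rpow_pos_of_pos (Real.exp_pos u) (-σ))]
    ring
  have e2 : ∀ u, |Real.exp u| • (g (Real.exp u) ^ 2 * Real.exp u ^ (1 - 2 * σ)) = h0 u ^ 2 := by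
    intro u
    have : Real.exp ((1 - σ) * u) ^ 2 = Real.exp u * Real.exp u ^ (1 - 2 * σ) := by
      rw [← Real.exp_mul, ← Real.exp_add, ← Real.exp_nat_mul]; push_cast; ring_nf
    simp only [h0, Real.abs_exp, smul_eq_mul, mul_pow, this]
    ring
  simp only [e1] at h1
  simp only [e2] at h2 ⊢
  have hi1 : Integrable h := by
    rw [integrable_indicator_iff hsm]
    exact (integrable_norm_iff (Complex.measurable_ofReal.comp hm0).aestronglyMeasurable).1 h1
  have hi2 : MemLp h 2 := by
    rw [memLp_two_iff_integrable_sq_norm hm.aestronglyMeasurable]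
    simp only [hnorm]
    rw [integrable_indicator_iff hsm]
    exact h2
  obtain ⟨p1, p2⟩ := plancherel_aux h hi1 hi2
  simp only [hnorm] at p2
  rw [integral_indicator hsm] at p2
  rw [← p2]
  have e3 : ∀ t : ℝ, (∫ x in Real.exp '' s,
      ((g x : ℝ) : ℂ) * (x : ℂ) ^ (-(σ : ℂ) - Complex.I * t)) = 𝓕 h (t / (2 * Real.pi)) := by
    intro t
    rw [integral_image_eq_integral_abs_deriv_smul hsm hd hinj, Real.fourier_real_eq_integral_exp_smul,
      ← integral_indicator hsm]
    congr 1
    ext u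
    by_cases hu : u ∈ s
    · simp only [h, Set.indicator_of_mem hu, h0]
      rw [Complex.cpow_def_of_ne_zero (by exact_mod_cast (Real.exp_pos u).ne'),
        ← Complex.ofReal_log (Real.exp_pos u).le, Real.log_exp, Real.abs_exp, Complex.real_smul,
        smul_eq_mul]
      push_cast
      have hpi : (Real.pi : ℂ) ≠ 0 := by exact_mod_cast Real.pi_ne_zero
      have : cexp u * cexp (u * (-(σ : ℂ) - I * t)) =
          cexp (-2 * Real.pi * u * (t / (2 * Real.pi)) * I) * cexp ((1 - σ) * u) := by
        rw [← Complex.exp_add, ← Complex.exp_add]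
        congr 1
        field_simp
        ring
      linear_combination (g (Real.exp u) : ℂ) * this
    · simp [h, hu]
  simp only [e3]
  have hpi := Real.pi_pos
  have e4 : ∫ t, ‖𝓕 h (t / (2 * Real.pi))‖ ^ 2 = 2 * Real.pi * ∫ t, ‖𝓕 h t‖ ^ 2 := by
    rw [Measure.integral_comp_div (fun t => ‖𝓕 h t‖ ^ 2)]
    rw [abs_of_pos (by positivity), smul_eq_mul]
  rw [← e4, intervalIntegral.integral_of_le hT.le]
  apply setIntegral_le_integral
  · exact p1.comp_div (by positivity)
  · exact Filter.Eventually.of_forall fun t => by positivity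
end

section
/- Let σ ∈ ℝ be fixed. There exists C > 0 such that for all Y ≥ 2, ∫_Y^{2Y} | |ζ(1/2+ix)|⁴ − Q₄(log x) | · |E₂(x)| · x^{−σ} dx ≪_σ Y^{3/2−σ}(log Y)^C. -/
open MeasureTheory Complex

lemma aux_abs (x : ℝ) : HasDerivAt (fun x : ℝ => x * |x|) (2 * |x|) x := by
  rcases lt_trichotomy x 0 with h | h | h
  · have := (hasDerivAt_id x).mul (hasDerivAt_abs_neg h)
    refine HasDerivAt.congr_deriv this ?_
    simp only [id, abs_of_neg h]; ring
  · subst h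
    rw [hasDerivAt_iff_tendsto_slope]
    have : Filter.Tendsto (fun x : ℝ => |x|) (nhdsWithin 0 {0}ᶜ) (nhds (2 * |(0:ℝ)|)) := by
      have h : Filter.Tendsto (fun x : ℝ => |x|) (nhds 0) (nhds |0|) := continuous_abs.tendsto 0
      simpa using h.mono_left nhdsWithin_le_nhds
    refine this.congr' ?_
    filter_upwards [self_mem_nhdsWithin] with y hy
    have hy : y ≠ 0 := hy
    simp [slope_def_field]
    field_simp
  · have := (hasDerivAt_id x).mul (hasDerivAt_abs_pos h)
    refine HasDerivAt.congr_deriv this ?_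
    simp only [id, abs_of_pos h]; ring

lemma aux_zeta : Continuous (fun x : ℝ => ‖riemannZeta (1/2 + Complex.I * x)‖ ^ 4) := by
  refine Continuous.pow (Continuous.norm ?_) 4
  rw [continuous_iff_continuousAt]
  intro x
  have hne : (1/2 + Complex.I * x : ℂ) ≠ 1 := by
    intro h
    have := congrArg Complex.re h
    norm_num at this
  exact ContinuousAt.comp (f := fun x : ℝ => (1/2 + Complex.I * x : ℂ))
    (differentiableAt_riemannZeta hne).continuousAt (by fun_prop)

lemma aux_poly (Q : Polynomial ℝ) : ∃ B > 0, ∃ n : ℕ, ∀ u : ℝ, ∀ M : ℝ, 0 ≤ u → u ≤ M → 1 ≤ M →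
    |Q.eval u| ≤ B * M ^ n := by
  refine ⟨∑ i ∈ Finset.range (Q.natDegree + 1), |Q.coeff i| + 1, by positivity, Q.natDegree, ?_⟩
  intro u M hu hM h1
  rw [Polynomial.eval_eq_sum_range]
  calc |∑ i ∈ Finset.range (Q.natDegree + 1), Q.coeff i * u ^ i|
      ≤ ∑ i ∈ Finset.range (Q.natDegree + 1), |Q.coeff i * u ^ i| := Finset.abs_sum_le_sum_abs _ _
    _ ≤ ∑ i ∈ Finset.range (Q.natDegree + 1), |Q.coeff i| * M ^ Q.natDegree := by
        refine Finset.sum_le_sum fun i hi => ?_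
        rw [abs_mul, abs_of_nonneg (pow_nonneg hu i)]
        gcongr
        calc u ^ i ≤ M ^ i := by gcongr
          _ ≤ _ := pow_le_pow_right₀ h1 (by have := Finset.mem_range.1 hi; omega)
    _ = (∑ i ∈ Finset.range (Q.natDegree + 1), |Q.coeff i|) * M ^ Q.natDegree := by
        rw [Finset.sum_mul]
    _ ≤ _ := by
        have : 0 ≤ M ^ Q.natDegree := by positivity
        nlinarith

lemma aux_main_s9 (f q E : ℝ → ℝ) (hf0 : ∀ x, 0 ≤ f x) (hf : Continuous f)
    (hq : ContinuousOn q (Set.Ioi 0))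
    (hE : ∀ x, 0 < x → HasDerivAt E (f x - q x) x) (Y W D : ℝ) (hY : 2 ≤ Y)
    (hW : ∀ x ∈ Set.Icc Y (2 * Y), |q x| ≤ W)
    (hD : (∫ t in (1:ℝ)..(2 * Y), (E t) ^ 2) ≤ D) (σ : ℝ) :
    (∫ x in Y..(2 * Y), |f x - q x| * |E x| * x ^ (-σ)) ≤
      2 ^ |σ| * Y ^ (-σ) * ((E (2 * Y)) ^ 2 / 2 + (E Y) ^ 2 / 2 +
        W * (D / √Y + Y * √Y)) := by
  have hY0 : 0 < Y := by linarith
  have hle : Y ≤ 2 * Y := by linarith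
  have hsub : Set.Icc Y (2 * Y) ⊆ Set.Ioi 0 := fun x hx => lt_of_lt_of_le hY0 hx.1
  have hsub1 : Set.Icc 1 (2 * Y) ⊆ Set.Ioi 0 := fun x hx => lt_of_lt_of_le one_pos hx.1
  have hEc0 : ContinuousOn E (Set.Ioi 0) := fun x hx => (hE x hx).continuousAt.continuousWithinAt
  have hEc := hEc0.mono hsub
  have hqc := hq.mono hsub
  have hfc : ContinuousOn f (Set.Icc Y (2 * Y)) := hf.continuousOn
  have hxc : ContinuousOn (fun x : ℝ => x ^ (-σ)) (Set.Icc Y (2 * Y)) := fun x hx =>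
    (Real.continuousAt_rpow_const x (-σ) (Or.inl (hsub hx).ne')).continuousWithinAt
  have hI : ∀ g : ℝ → ℝ, ContinuousOn g (Set.Icc Y (2 * Y)) →
      IntervalIntegrable g volume Y (2 * Y) := fun g hg => hg.intervalIntegrable_of_Icc hle
  have hW0 : 0 ≤ W := (abs_nonneg _).trans (hW Y ⟨le_rfl, hle⟩)
  have hs : 0 < √Y := Real.sqrt_pos.2 hY0
  -- power bound
  have hpow : ∀ x ∈ Set.Icc Y (2 * Y), x ^ (-σ) ≤ 2 ^ |σ| * Y ^ (-σ) := by
    intro x hx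
    have h1 : 1 ≤ x / Y := by rw [le_div_iff₀ hY0]; linarith [hx.1]
    have h2 : x / Y ≤ 2 := by rw [div_le_iff₀ hY0]; linarith [hx.2]
    have : x ^ (-σ) = (x / Y) ^ (-σ) * Y ^ (-σ) := by
      rw [← Real.mul_rpow (by positivity) hY0.le, div_mul_cancel₀ _ hY0.ne']
    rw [this]
    gcongr
    calc (x / Y) ^ (-σ) ≤ (x / Y) ^ |σ| := Real.rpow_le_rpow_of_exponent_le h1 (neg_le_abs σ)
      _ ≤ 2 ^ |σ| := Real.rpow_le_rpow (by positivity) h2 (abs_nonneg _)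
  have hFTC : ∫ x in Y..(2 * Y), (f x - q x) * |E x| =
      E (2 * Y) * |E (2 * Y)| / 2 - E Y * |E Y| / 2 := by
    refine intervalIntegral.integral_eq_sub_of_hasDerivAt (f := fun x => E x * |E x| / 2) ?_
      (hI _ (by fun_prop))
    intro x hx
    rw [Set.uIcc_of_le hle] at hx
    have := ((aux_abs (E x)).comp x (hE x (hsub hx))).div_const 2
    refine HasDerivAt.congr_deriv this ?_
    ring
  have hEsq : ∫ x in Y..(2 * Y), (E x) ^ 2 ≤ D := by
    refine le_trans ?_ hD
    refine intervalIntegral.integral_mono_interval (by linarith) hle le_rfl ?_ ?_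
    · exact Filter.Eventually.of_forall fun x => sq_nonneg _
    · exact ((hEc0.mono hsub1).pow 2).intervalIntegrable_of_Icc (by linarith)
  have key : ∀ x ∈ Set.Icc Y (2 * Y), |f x - q x| * |E x| * x ^ (-σ) ≤
      2 ^ |σ| * Y ^ (-σ) * ((f x - q x) * |E x| + W * ((E x) ^ 2 / √Y + √Y)) := by
    intro x hx
    have h1 : |f x - q x| ≤ (f x - q x) + 2 * W := by
      have := abs_le.1 (hW x hx)
      rw [abs_le]; constructor <;> linarith [hf0 x]
    have h2 : 2 * |E x| ≤ (E x) ^ 2 / √Y + √Y := by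
      have : (E x) ^ 2 / √Y + √Y - 2 * |E x| = (|E x| - √Y) ^ 2 / √Y := by
        field_simp
        rw [← sq_abs (E x)]; ring
      have : 0 ≤ (|E x| - √Y) ^ 2 / √Y := by positivity
      linarith
    have h3 : |f x - q x| * |E x| ≤ (f x - q x) * |E x| + W * ((E x) ^ 2 / √Y + √Y) := by
      have := mul_le_mul_of_nonneg_right h1 (abs_nonneg (E x))
      have := mul_le_mul_of_nonneg_left h2 hW0
      linarith
    have hx0 : 0 < x := hsub hx
    calc |f x - q x| * |E x| * x ^ (-σ) ≤ |f x - q x| * |E x| * (2 ^ |σ| * Y ^ (-σ)) := by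
          gcongr; exact hpow x hx
      _ = (2 ^ |σ| * Y ^ (-σ)) * (|f x - q x| * |E x|) := by ring
      _ ≤ _ := by gcongr
  refine (intervalIntegral.integral_mono_on hle (hI _ (by fun_prop)) (hI _ (by fun_prop)) key).trans ?_
  rw [intervalIntegral.integral_const_mul]
  gcongr
  rw [intervalIntegral.integral_add (hI _ (by fun_prop)) (hI _ (by fun_prop)), hFTC,
    intervalIntegral.integral_const_mul, intervalIntegral.integral_add (hI _ (by fun_prop))
    (hI _ (by fun_prop)), intervalIntegral.integral_div, intervalIntegral.integral_const]
  have h1 : E (2 * Y) * |E (2 * Y)| ≤ E (2 * Y) ^ 2 := by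
    rw [← sq_abs (E (2 * Y))]; nlinarith [le_abs_self (E (2 * Y)), abs_nonneg (E (2 * Y))]
  have h2 : -(E Y * |E Y|) ≤ E Y ^ 2 := by
    rw [← sq_abs (E Y)]; nlinarith [neg_le_abs (E Y), abs_nonneg (E Y)]
  have h3 : (∫ x in Y..(2 * Y), (E x) ^ 2) / √Y ≤ D / √Y := by gcongr
  have h4 : (2 * Y - Y) • √Y = Y * √Y := by rw [smul_eq_mul]; ring
  rw [h4]
  have h5 := mul_le_mul_of_nonneg_left (add_le_add_left h3 (Y * √Y)) hW0
  linarith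

theorem stmt_9
    (P4 : Polynomial ℝ) (hdeg : P4.degree = 4)
    (hlead : P4.leadingCoeff = 1 / (2 * Real.pi ^ 2))
    (E2 : ℝ → ℝ)
    (hE2 : ∀ T : ℝ, E2 T =
      (∫ t in (0:ℝ)..T, ‖riemannZeta (1/2 + Complex.I * t)‖ ^ 4)
        - T * P4.eval (Real.log T))
    (hpt : ∀ ε > 0, ∃ C > 0, ∀ T : ℝ, 2 ≤ T → |E2 T| ≤ C * T ^ ((2:ℝ)/3 + ε))
    (hms : ∃ C > 0, ∃ A > 0, ∀ T : ℝ, 2 ≤ T →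
      (∫ t in (1:ℝ)..T, (E2 t) ^ 2) ≤ A * T ^ 2 * Real.log T ^ C)
    (σ : ℝ) :
    ∃ C > 0, ∃ A > 0, ∀ Y : ℝ, 2 ≤ Y →
      (∫ x in Y..(2 * Y),
        |‖riemannZeta (1/2 + Complex.I * x)‖ ^ 4
            - (P4 + Polynomial.derivative P4).eval (Real.log x)| * |E2 x| * x ^ (-σ))
        ≤ A * Y ^ (3/2 - σ) * Real.log Y ^ C := by
  have hder : ∀ x : ℝ, 0 < x → HasDerivAt E2 (‖riemannZeta (1/2 + Complex.I * x)‖ ^ 4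
            - (P4 + Polynomial.derivative P4).eval (Real.log x)) x := by
    intro x hx
    have h1 := intervalIntegral.integral_hasDerivAt_right
      (aux_zeta.intervalIntegrable 0 x) (aux_zeta.stronglyMeasurableAtFilter _ _) aux_zeta.continuousAt
    have h2 := (hasDerivAt_id x).mul ((P4.hasDerivAt (Real.log x)).comp x
      (Real.hasDerivAt_log hx.ne'))
    have h3 := h1.sub h2
    have hfun : E2 = fun T => (∫ t in (0:ℝ)..T, ‖riemannZeta (1/2 + Complex.I * t)‖ ^ 4)
        - T * P4.eval (Real.log T) := funext hE2
    rw [hfun]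
    refine HasDerivAt.congr_deriv h3 ?_
    simp
    field_simp
  obtain ⟨B, hB, n, hQ⟩ := aux_poly (P4 + Polynomial.derivative P4)
  obtain ⟨c, hc, A, hA, hms⟩ := hms
  obtain ⟨K, hK, hpt⟩ := hpt (1/12) (by norm_num)
  have hsq : ∀ T : ℝ, 2 ≤ T → E2 T ^ 2 ≤ K ^ 2 * (T * √T) := by
    intro T hT
    have hT0 : 0 < T := by linarith
    have h := hpt T hT
    have h' : (T ^ ((2:ℝ)/3 + 1/12)) ^ 2 = T * √T := by
      rw [← Real.rpow_natCast, ← Real.rpow_mul hT0.le, Real.sqrt_eq_rpow]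
      nth_rewrite 2 [← Real.rpow_one T]
      rw [← Real.rpow_add hT0]; norm_num
    rw [← sq_abs, ← h', ← mul_pow]
    gcongr
  refine ⟨n + c, by positivity, 2 ^ |σ| * (3 * K ^ 2 + B * (4 * A + 1)) * 4 ^ (n + c), by positivity, ?_⟩
  intro Y hY
  have hY0 : 0 < Y := by linarith
  have hs : 0 < √Y := Real.sqrt_pos.2 hY0
  have hL2 : (1/2 : ℝ) ≤ Real.log Y :=
    le_trans (by linarith [Real.log_two_gt_d9]) (Real.log_le_log (by norm_num) hY)
  have hlog2 : Real.log (2 * Y) ≤ 4 * Real.log Y := by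
    rw [Real.log_mul (by norm_num) hY0.ne']
    have := Real.log_le_log (by norm_num) hY
    linarith
  set M := 4 * Real.log Y with hM
  have hM1 : 1 ≤ M := by linarith
  have hlog0 : 0 ≤ Real.log (2 * Y) := Real.log_nonneg (by linarith)
  have h := aux_main_s9 (fun x : ℝ => ‖riemannZeta (1/2 + Complex.I * x)‖ ^ 4)
    (fun x => (P4 + Polynomial.derivative P4).eval (Real.log x)) E2 (fun x => by positivity)
    aux_zeta ((Polynomial.continuous _).comp_continuousOn
      (Real.continuousOn_log.mono fun x hx => (ne_of_gt hx : x ≠ 0))) hder Y (B * M ^ n)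
    (A * (2 * Y) ^ 2 * M ^ c) hY
    (by
      intro x hx
      refine hQ _ _ (Real.log_nonneg (by linarith [hx.1])) ?_ hM1
      exact (Real.log_le_log (by linarith [hx.1]) hx.2).trans hlog2)
    (by
      refine (hms (2 * Y) (by linarith)).trans ?_
      gcongr) σ
  refine h.trans ?_
  have e1 := hsq Y hY
  have e2 := hsq (2 * Y) (by linarith)
  have e3 : √(2 * Y) ≤ 2 * √Y := by
    rw [Real.sqrt_le_left (by positivity), mul_pow, Real.sq_sqrt hY0.le]; linarith
  have e4 : 2 * Y * √(2 * Y) ≤ 4 * (Y * √Y) := by nlinarith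
  have e5 : E2 (2 * Y) ^ 2 ≤ 4 * K ^ 2 * (Y * √Y) := by
    have := mul_le_mul_of_nonneg_left e4 (sq_nonneg K); linarith
  have e6 : Y ^ (3/2 - σ) = Y ^ (-σ) * (Y * √Y) := by
    rw [Real.sqrt_eq_rpow]
    nth_rewrite 3 [← Real.rpow_one Y]
    rw [← Real.rpow_add hY0, ← Real.rpow_add hY0]; congr 1; ring
  have e7 : A * (2 * Y) ^ 2 * M ^ c / √Y = 4 * A * M ^ c * (Y * √Y) := by
    have := Real.sq_sqrt hY0.le
    field_simp
    rw [this]; ring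
  have m1 : 1 ≤ M ^ c := one_le_pow₀ hM1
  have m2 : 1 ≤ M ^ n := one_le_pow₀ hM1
  have m3 : 1 ≤ M ^ n * M ^ c := one_le_mul_of_one_le_of_one_le m2 m1
  have e8 : A * (2 * Y) ^ 2 * M ^ c / √Y + Y * √Y ≤ (4 * A + 1) * M ^ c * (Y * √Y) := by
    rw [e7]
    have := mul_le_mul_of_nonneg_right m1 (by positivity : 0 ≤ Y * √Y)
    linarith
  have e9 : E2 (2 * Y) ^ 2 / 2 + E2 Y ^ 2 / 2 ≤ 3 * K ^ 2 * (Y * √Y) * (M ^ n * M ^ c) := by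
    have := mul_le_mul_of_nonneg_left m3 (by positivity : 0 ≤ 3 * K ^ 2 * (Y * √Y))
    have : 0 ≤ K ^ 2 * (Y * √Y) := by positivity
    linarith
  have e10 := mul_le_mul_of_nonneg_left e8 (by positivity : 0 ≤ B * M ^ n)
  calc _ ≤ 2 ^ |σ| * Y ^ (-σ) * (3 * K ^ 2 * (Y * √Y) * (M ^ n * M ^ c) +
        B * M ^ n * ((4 * A + 1) * M ^ c * (Y * √Y))) := by gcongr
    _ = _ := by
      rw [e6, hM, mul_pow, mul_pow, pow_add, pow_add]; ring
end
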